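/- arXiv:2509.22109 — 2 statements merged into one kernel-verified Lean document; each statement's English description precedes it below -/
import Mathlib

section
/- Let c ∈ 𝕋 and let μ be a g-measure for g^c, regarded as a Borel probability measure on [0,1] ⊂ ℝ. For r > 0 set q_r = inf{q > 0 : β̄_μ(q) < r·q}. Then the quantization dimension of μ of order r exists, i.e. D̄_r(μ) = D̲_r(μ), and D_r(μ) = r·q_r/(1 − q_r). -/
open MeasureTheory Filter Topology Set
open scoped ENNReal

noncomputable section

namespace GTM

abbrev Torus := AddCircle (1 : ℝ)

instance : Fact ((0:ℝ) < 1) := ⟨one_pos⟩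

/-- The left endpoint of the dyadic cylinder interval of a binary word. -/
def wordVal (n : ℕ) (ω : Fin n → Bool) : ℝ :=
  ∑ i : Fin n, (if ω i then (1 : ℝ) else 0) / 2 ^ ((i : ℕ) + 1)

/-- The closed dyadic interval `⟨ω⟩ ⊆ 𝕋` associated to a binary word `ω`. -/
def cyl (n : ℕ) (ω : Fin n → Bool) : Set Torus :=
  (fun x : ℝ => (x : Torus)) '' Set.Icc (wordVal n ω) (wordVal n ω + 1 / 2 ^ n)

/-- `Σ_{ω ∈ {0,1}ⁿ} ν(⟨ω⟩)^q`. -/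
def lqSum (ν : Measure Torus) (q : ℝ) (n : ℕ) : ℝ :=
  ∑ ω : Fin n → Bool, ((ν (cyl n ω)).toReal) ^ q

/-- The upper `L^q`-spectrum `β̄_ν(q)`. -/
def lqUpper (ν : Measure Torus) (q : ℝ) : EReal :=
  atTop.limsup fun n : ℕ =>
    ((((n : ℝ) * Real.log 2)⁻¹ * Real.log (lqSum ν q n) : ℝ) : EReal)

/-- The lower `L^q`-spectrum `β̲_ν(q)`. -/
def lqLower (ν : Measure Torus) (q : ℝ) : EReal :=
  atTop.liminf fun n : ℕ =>
    ((((n : ℝ) * Real.log 2)⁻¹ * Real.log (lqSum ν q n) : ℝ) : EReal)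

/-- The function `x ↦ |cos (π x)|` lifted to the torus. -/
def absCos : Torus → ℝ :=
  Function.Periodic.lift (f := fun x : ℝ => |Real.cos (Real.pi * x)|)
    (by
      intro x
      simp [mul_add, mul_one, Real.cos_add_pi, abs_neg])

/-- The `g`-function `g^c(x) = cos² (π (x - c))`. -/
def gfun (c : Torus) (x : Torus) : ℝ := (absCos (x - c)) ^ 2

/-- The halving map `x ↦ x/2` on the torus, computed on the representative in `[0,1)`. -/
def half (x : Torus) : Torus := (((AddCircle.equivIco 1 0 x : ℝ) / 2 : ℝ) : Torus)

/-- `μ` is a `g`-measure for `g^c`: it is a Borel probability measure invariant under the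
dual transfer operator of `g^c`. -/
def IsGMeasure (c : Torus) (μ : Measure Torus) : Prop :=
  IsProbabilityMeasure μ ∧
    ∀ f : C(Torus, ℝ),
      ∫ x, f x ∂μ =
        ∫ x,
          (gfun c (half x) * f (half x) +
            gfun c (half x + (((1 : ℝ) / 2 : ℝ) : Torus)) *
              f (half x + (((1 : ℝ) / 2 : ℝ) : Torus))) ∂μ

/-- The identification of `𝕋` with `[0,1) ⊂ ℝ`. -/
def circleToReal (x : Torus) : ℝ := (AddCircle.equivIco 1 0 x : ℝ)

/-- The `n`-th quantization error of order `r > 0` of a measure `ν` on `ℝ`: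
`e_{n,r}(ν) = inf {(∫ dist(x,α)^r dν)^{1/r} : α ⊆ ℝ, 1 ≤ #α ≤ n}`. -/
def quantErr (ν : Measure ℝ) (r : ℝ) (n : ℕ) : ℝ :=
  sInf {e : ℝ | ∃ α : Finset ℝ, α.Nonempty ∧ α.card ≤ n ∧
    e = (∫ x, Metric.infDist x (α : Set ℝ) ^ r ∂ν) ^ (1 / r)}

lemma circleToReal_mem (x : Torus) : circleToReal x ∈ Ico (0 : ℝ) 1 := by
  have := (AddCircle.equivIco 1 0 x).2
  simpa [circleToReal] using this

lemma coe_circleToReal (x : Torus) : ((circleToReal x : ℝ) : Torus) = x :=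
  AddCircle.coe_equivIco

lemma circleToReal_coe {t : ℝ} (ht : t ∈ Ico (0 : ℝ) 1) : circleToReal (t : Torus) = t :=
  AddCircle.equivIco_coe_of_mem (p := (1 : ℝ)) (a := 0) (by simpa using ht)

lemma measurable_circleToReal : Measurable circleToReal :=
  measurable_subtype_coe.comp (AddCircle.measurableEquivIco (1 : ℝ) 0).measurable

lemma half_eq (x : Torus) : half x = ((circleToReal x / 2 : ℝ) : Torus) := rfl

lemma half_add_eq (x : Torus) :
    half x + (((1 : ℝ) / 2 : ℝ) : Torus) = (((circleToReal x + 1) / 2 : ℝ) : Torus) := by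
  rw [half_eq, ← AddCircle.coe_add, add_div]

lemma measurable_half : Measurable half :=
  (AddCircle.measurable_mk' (a := (1 : ℝ))).comp (measurable_circleToReal.div_const 2)

/-- The `g`-function with parameter `c`, as a function on `ℝ`. -/
def gReal (c t : ℝ) : ℝ := Real.cos (Real.pi * (t - c)) ^ 2

lemma continuous_gReal (c : ℝ) : Continuous (gReal c) := by
  unfold gReal; fun_prop

lemma gReal_nonneg (c t : ℝ) : 0 ≤ gReal c t := sq_nonneg _

lemma gReal_le_one (c t : ℝ) : gReal c t ≤ 1 := Real.cos_sq_le_one _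

lemma gReal_add_one (c t : ℝ) : gReal c (t + 1) = gReal c t := by
  have : Real.pi * (t + 1 - c) = Real.pi * (t - c) + Real.pi := by ring
  rw [gReal, this, Real.cos_add_pi, neg_sq, gReal]

lemma gReal_add_nat (c t : ℝ) (n : ℕ) : gReal c (t + n) = gReal c t := by
  induction n with
  | zero => simp
  | succ n ih => rw [Nat.cast_succ, ← add_assoc, gReal_add_one, ih]

lemma gReal_half_add (c x : ℝ) : gReal c (x / 2) + gReal c ((x + 1) / 2) = 1 := by
  have : Real.pi * ((x + 1) / 2 - c) = Real.pi * (x / 2 - c) + Real.pi / 2 := by ring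
  rw [gReal, gReal, this, Real.cos_add_pi_div_two, neg_sq, Real.cos_sq_add_sin_sq]

lemma gfun_coe (c : Torus) (t : ℝ) : gfun c (t : Torus) = gReal (circleToReal c) t := by
  have h : (t : Torus) - c = ((t - circleToReal c : ℝ) : Torus) := by
    rw [AddCircle.coe_sub, coe_circleToReal]
  rw [gfun, h, gReal, ← sq_abs (Real.cos _)]
  rfl

lemma measurable_gfun_half (c : Torus) : Measurable fun x => gfun c (half x) := by
  simp only [half_eq, gfun_coe]
  exact (continuous_gReal _).measurable.comp (measurable_circleToReal.div_const 2)

lemma measurable_gfun_half_add (c : Torus) :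
    Measurable fun x => gfun c (half x + (((1 : ℝ) / 2 : ℝ) : Torus)) := by
  simp only [half_add_eq, gfun_coe]
  exact (continuous_gReal _).measurable.comp
    ((measurable_circleToReal.add_const 1).div_const 2)

lemma gfun_nonneg (c x : Torus) : 0 ≤ gfun c x := sq_nonneg _

lemma gfun_le_one (c x : Torus) : gfun c x ≤ 1 := by
  rw [← coe_circleToReal x, gfun_coe]; exact gReal_le_one _ _

/-- The dual transfer operator of `g^c`, as an operation on measures. -/
def dualTransfer (c : Torus) (μ : Measure Torus) : Measure Torus :=
  (μ.withDensity fun x => ENNReal.ofReal (gfun c (half x))).map half +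
    (μ.withDensity fun x =>
      ENNReal.ofReal (gfun c (half x + (((1 : ℝ) / 2 : ℝ) : Torus)))).map
        fun x => half x + (((1 : ℝ) / 2 : ℝ) : Torus)

lemma isFiniteMeasure_withDensity_of_le_one (μ : Measure Torus) [IsFiniteMeasure μ]
    {f : Torus → ℝ} (hf : ∀ x, f x ≤ 1) :
    IsFiniteMeasure (μ.withDensity fun x => ENNReal.ofReal (f x)) := by
  refine isFiniteMeasure_withDensity (ne_of_lt ?_)
  calc ∫⁻ x, ENNReal.ofReal (f x) ∂μ ≤ ∫⁻ _, 1 ∂μ :=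
        lintegral_mono fun x => by simpa using hf x
    _ < ⊤ := by simp

lemma IsGMeasure.eq_dualTransfer {c : Torus} {μ : Measure Torus} (hμ : IsGMeasure c μ) :
    μ = dualTransfer c μ := by
  have := hμ.1
  have h1 := isFiniteMeasure_withDensity_of_le_one μ (fun x => gfun_le_one c (half x))
  have h2 := isFiniteMeasure_withDensity_of_le_one μ
    (fun x => gfun_le_one c (half x + (((1 : ℝ) / 2 : ℝ) : Torus)))
  have hm2 : Measurable fun x => half x + (((1 : ℝ) / 2 : ℝ) : Torus) :=
    measurable_half.add_const _
  have : IsFiniteMeasure (dualTransfer c μ) := by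
    unfold dualTransfer; infer_instance
  apply ext_of_forall_integral_eq_of_IsFiniteMeasure
  intro f
  have key := hμ.2 f.toContinuousMap
  have hb : ∀ (ρ : Measure Torus) [IsFiniteMeasure ρ], Integrable (fun x => f x) ρ := fun ρ _ =>
    f.integrable ρ
  have hinteg : ∀ (g : Torus → ℝ) (u : Torus → Torus), Measurable g → (∀ x, 0 ≤ g x) →
      (∀ x, g x ≤ 1) → Measurable u → Integrable (fun x => g x * f (u x)) μ := by
    intro g u hg h0 h1 hu
    refine Integrable.bdd_mul (c := 1) ?_ hg.aestronglyMeasurable ?_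
    · exact (hb (μ.map u)).comp_measurable hu
    · exact Eventually.of_forall fun x => by
        rw [Real.norm_eq_abs, abs_of_nonneg (h0 x)]; exact h1 x
  have hpart : ∀ (g : Torus → ℝ) (u : Torus → Torus), Measurable g → (∀ x, 0 ≤ g x) →
      Measurable u → ∫ x, f x ∂((μ.withDensity fun x => ENNReal.ofReal (g x)).map u) =
        ∫ x, g x * f (u x) ∂μ := by
    intro g u hg h0 hu
    rw [integral_map hu.aemeasurable f.continuous.measurable.aestronglyMeasurable,
      integral_withDensity_eq_integral_toReal_smul hg.ennreal_ofReal
        (Eventually.of_forall fun x => ENNReal.ofReal_lt_top)]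
    refine integral_congr_ae (Eventually.of_forall fun x => ?_)
    simp [ENNReal.toReal_ofReal (h0 x)]
  have e1 := hpart _ _ (measurable_gfun_half c) (fun x => gfun_nonneg _ _) measurable_half
  have e2 := hpart _ _ (measurable_gfun_half_add c) (fun x => gfun_nonneg _ _) hm2
  rw [dualTransfer, integral_add_measure (hb _) (hb _), e1, e2, ← integral_add]
  · exact key
  · exact hinteg _ _ (measurable_gfun_half c) (fun x => gfun_nonneg _ _)
      (fun x => gfun_le_one _ _) measurable_half
  · exact hinteg _ _ (measurable_gfun_half_add c) (fun x => gfun_nonneg _ _)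
      (fun x => gfun_le_one _ _) hm2

/-- Invariance of a measure on `ℝ` carried by `[0,1)` under the dual transfer operator. -/
structure IsRealGMeasure (c : ℝ) (ν : Measure ℝ) : Prop where
  prob : IsProbabilityMeasure ν
  ae_mem : ∀ᵐ x ∂ν, x ∈ Ico (0 : ℝ) 1
  lintegral_eq : ∀ f : ℝ → ℝ≥0∞, Measurable f → ∫⁻ x, f x ∂ν =
    ∫⁻ x, (ENNReal.ofReal (gReal c (x / 2)) * f (x / 2) +
      ENNReal.ofReal (gReal c ((x + 1) / 2)) * f ((x + 1) / 2)) ∂ν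

lemma IsGMeasure.isRealGMeasure {c : Torus} {μ : Measure Torus} (hμ : IsGMeasure c μ) :
    IsRealGMeasure (circleToReal c) (μ.map circleToReal) := by
  have := hμ.1
  refine ⟨Measure.isProbabilityMeasure_map measurable_circleToReal.aemeasurable, ?_, ?_⟩
  · exact (ae_map_iff measurable_circleToReal.aemeasurable
      (p := fun x => x ∈ Ico (0 : ℝ) 1) measurableSet_Ico).2
      (Eventually.of_forall circleToReal_mem)
  · intro f hf
    have hg := (continuous_gReal (circleToReal c)).measurable
    have hm2 : Measurable fun x => half x + (((1 : ℝ) / 2 : ℝ) : Torus) :=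
      measurable_half.add_const _
    have hF : Measurable fun x => f (circleToReal x) := hf.comp measurable_circleToReal
    have hF1 : Measurable fun x => f (circleToReal (half x)) := hF.comp measurable_half
    have hF2 : Measurable fun x => f (circleToReal (half x + (((1 : ℝ) / 2 : ℝ) : Torus))) :=
      hF.comp hm2
    rw [lintegral_map hf measurable_circleToReal, lintegral_map (by fun_prop)
      measurable_circleToReal]
    conv_lhs => rw [hμ.eq_dualTransfer]
    rw [dualTransfer, lintegral_add_measure, lintegral_map hF measurable_half,
      lintegral_map hF hm2,
      lintegral_withDensity_eq_lintegral_mul _ (measurable_gfun_half c).ennreal_ofReal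
        hF1,
      lintegral_withDensity_eq_lintegral_mul _ (measurable_gfun_half_add c).ennreal_ofReal
        hF2, ← lintegral_add_left]
    · refine lintegral_congr fun x => ?_
      have hx := circleToReal_mem x
      have m1 : circleToReal x / 2 ∈ Ico (0 : ℝ) 1 := ⟨by linarith [hx.1], by linarith [hx.2]⟩
      have m2 : (circleToReal x + 1) / 2 ∈ Ico (0 : ℝ) 1 :=
        ⟨by linarith [hx.1], by linarith [hx.2]⟩
      simp only [Pi.mul_apply, half_add_eq]
      simp only [half_eq, gfun_coe,
        circleToReal_coe m1, circleToReal_coe m2]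
    · exact (measurable_gfun_half c).ennreal_ofReal.mul hF1

/-- The product of the `g`-function along the inverse branch of order `n` with index `k`. -/
def weight (c : ℝ) (n k : ℕ) (x : ℝ) : ℝ :=
  ∏ j ∈ Finset.range n, gReal c ((x + k) / 2 ^ (j + 1))

lemma continuous_weight (c : ℝ) (n k : ℕ) : Continuous (weight c n k) := by
  unfold weight
  exact continuous_finsetProd _ fun j _ => (continuous_gReal c).comp (by fun_prop)

lemma weight_nonneg (c : ℝ) (n k : ℕ) (x : ℝ) : 0 ≤ weight c n k x :=
  Finset.prod_nonneg fun _ _ => gReal_nonneg _ _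

lemma weight_le_one (c : ℝ) (n k : ℕ) (x : ℝ) : weight c n k x ≤ 1 :=
  Finset.prod_le_one (fun _ _ => gReal_nonneg _ _) fun _ _ => gReal_le_one _ _

lemma weight_succ (c : ℝ) (n k b : ℕ) (x : ℝ) :
    weight c (n + 1) (2 * k + b) x = gReal c ((x + b) / 2) * weight c n k ((x + b) / 2) := by
  rw [weight, Finset.prod_range_succ', mul_comm, weight]
  congr 1
  · rw [← gReal_add_nat c ((x + b) / 2) k]
    congr 1; push_cast; ring
  · refine Finset.prod_congr rfl fun j _ => ?_
    congr 1; push_cast; field_simp; ring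

lemma sum_range_two_mul {M : Type*} [AddCommMonoid M] (a : ℕ → M) (N : ℕ) :
    ∑ k ∈ Finset.range (2 * N), a k = ∑ i ∈ Finset.range N, (a (2 * i) + a (2 * i + 1)) := by
  induction N with
  | zero => simp
  | succ N ih =>
    rw [Finset.sum_range_succ, ← ih, mul_add, mul_one, Finset.sum_range_succ,
      Finset.sum_range_succ, add_assoc]

lemma sum_weight (c : ℝ) (n : ℕ) (x : ℝ) :
    ∑ k ∈ Finset.range (2 ^ n), weight c n k x = 1 := by
  induction n generalizing x with
  | zero => simp [weight]
  | succ n ih =>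
    have h0 := fun k => weight_succ c n k 0 x
    have h1 := fun k => weight_succ c n k 1 x
    simp only [Nat.cast_zero, add_zero, Nat.cast_one] at h0 h1
    rw [pow_succ', sum_range_two_mul, Finset.sum_add_distrib]
    simp only [h0, h1, ← Finset.mul_sum, ih, mul_one, gReal_half_add]

/-- The half-open dyadic interval of order `n` with index `k`. -/
def dyadic (n k : ℕ) : Set ℝ := Ico ((k : ℝ) / 2 ^ n) (((k : ℝ) + 1) / 2 ^ n)

lemma measurableSet_dyadic (n k : ℕ) : MeasurableSet (dyadic n k) := measurableSet_Ico

lemma dyadic_subset {n k : ℕ} (hk : k < 2 ^ n) : dyadic n k ⊆ Ico 0 1 := by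
  intro x hx
  have h2 : (0 : ℝ) < 2 ^ n := by positivity
  have hk' : (k : ℝ) + 1 ≤ 2 ^ n := by exact_mod_cast hk
  exact ⟨le_trans (by positivity) hx.1, lt_of_lt_of_le hx.2 ((div_le_one h2).2 hk')⟩

lemma dyadic_zero : dyadic 0 0 = Ico 0 1 := by simp [dyadic]

lemma mem_dyadic_iff {n k : ℕ} {x : ℝ} :
    x ∈ dyadic n k ↔ (k : ℝ) ≤ 2 ^ n * x ∧ 2 ^ n * x < k + 1 := by
  have h2 : (0 : ℝ) < 2 ^ n := by positivity
  rw [dyadic, mem_Ico, div_le_iff₀ h2, lt_div_iff₀ h2, mul_comm x]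

lemma mem_dyadic_add_iff {m M a d k : ℕ} (hd : d < 2 ^ M) {x : ℝ} (hx : x ∈ Ico (0 : ℝ) 1) :
    (x + k) / 2 ^ m ∈ dyadic (m + M) (a * 2 ^ M + d) ↔ k = a ∧ x ∈ dyadic M d := by
  have hd' : (d : ℝ) + 1 ≤ 2 ^ M := by exact_mod_cast hd
  have h2 : (0 : ℝ) < 2 ^ M := by positivity
  have e : (2 : ℝ) ^ (m + M) * ((x + k) / 2 ^ m) = 2 ^ M * (x + k) := by
    rw [pow_add]; field_simp
  rw [mem_dyadic_iff, mem_dyadic_iff, e]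
  push_cast
  constructor
  · rintro ⟨h3, h4⟩
    have ha : k = a := by
      have i1 : (a : ℝ) < k + 1 := by
        have : (2 : ℝ) ^ M * a < 2 ^ M * (k + 1) := by
          nlinarith [hx.2, Nat.cast_nonneg (α := ℝ) d]
        exact lt_of_mul_lt_mul_left this h2.le
      have i2 : (k : ℝ) < a + 1 := by
        have : (2 : ℝ) ^ M * k < 2 ^ M * (a + 1) := by
          nlinarith [mul_nonneg h2.le hx.1]
        exact lt_of_mul_lt_mul_left this h2.le
      have i1' : a < k + 1 := by exact_mod_cast i1
      have i2' : k < a + 1 := by exact_mod_cast i2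
      omega
    subst ha
    exact ⟨rfl, by linarith, by linarith⟩
  · rintro ⟨rfl, h3, h4⟩
    constructor <;> linarith

lemma dyadic_floor_mem {x : ℝ} (hx : x ∈ Ico (0 : ℝ) 1) (n : ℕ) :
    ⌊2 ^ n * x⌋₊ < 2 ^ n ∧ x ∈ dyadic n ⌊2 ^ n * x⌋₊ := by
  have h2 : (0 : ℝ) < 2 ^ n := by positivity
  have h0 : 0 ≤ 2 ^ n * x := mul_nonneg h2.le hx.1
  refine ⟨?_, mem_dyadic_iff.2 ⟨Nat.floor_le h0, Nat.lt_floor_add_one _⟩⟩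
  rw [Nat.floor_lt h0]
  push_cast
  nlinarith [hx.2]

lemma dyadic_index_eq {n k : ℕ} {x : ℝ} (hx : x ∈ dyadic n k) : ⌊2 ^ n * x⌋₊ = k := by
  rw [mem_dyadic_iff] at hx
  exact (Nat.floor_eq_iff (le_trans (Nat.cast_nonneg k) hx.1)).2 hx

lemma pairwise_disjoint_dyadic (n : ℕ) (s : Set ℕ) : s.PairwiseDisjoint (dyadic n) := by
  intro i _ j _ hij
  refine Set.disjoint_left.2 fun x hi hj => hij ?_
  rw [← dyadic_index_eq hi, dyadic_index_eq hj]

section RealGMeasure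

variable {c : ℝ} {ν : Measure ℝ}

lemma IsRealGMeasure.lintegral_iterate (h : IsRealGMeasure c ν) (n : ℕ) {f : ℝ → ℝ≥0∞}
    (hf : Measurable f) : ∫⁻ x, f x ∂ν =
      ∑ k ∈ Finset.range (2 ^ n),
        ∫⁻ x, ENNReal.ofReal (weight c n k x) * f ((x + k) / 2 ^ n) ∂ν := by
  induction n with
  | zero => simp [weight]
  | succ n ih =>
    rw [ih, pow_succ', sum_range_two_mul]
    refine Finset.sum_congr rfl fun k _ => ?_
    have hw : ∀ m k, Measurable (weight c m k) := fun m k => (continuous_weight c m k).measurable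
    have hw' := hw n k
    have hw0 := hw (n + 1) (2 * k)
    rw [h.lintegral_eq _ (by fun_prop), ← lintegral_add_left (by fun_prop)]
    refine lintegral_congr fun x => ?_
    have h0 := weight_succ c n k 0 x
    have h1 := weight_succ c n k 1 x
    simp only [Nat.cast_zero, add_zero, Nat.cast_one] at h0 h1
    rw [h0, h1, ENNReal.ofReal_mul (gReal_nonneg _ _), ENNReal.ofReal_mul (gReal_nonneg _ _),
      mul_assoc, mul_assoc]
    have e0 : (x / 2 + k) / 2 ^ n = (x + (2 * k : ℕ)) / 2 ^ (n + 1) := by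
      push_cast; field_simp; ring
    have e1 : ((x + 1) / 2 + k) / 2 ^ n = (x + (2 * k + 1 : ℕ)) / 2 ^ (n + 1) := by
      push_cast; field_simp; ring
    rw [e0, e1]

lemma integrable_weight [IsProbabilityMeasure ν] (n k : ℕ) : Integrable (weight c n k) ν :=
  Integrable.of_bound (continuous_weight c n k).aestronglyMeasurable 1
    (Eventually.of_forall fun x => by
      rw [Real.norm_eq_abs, abs_of_nonneg (weight_nonneg _ _ _ _)]
      exact weight_le_one _ _ _ _)

lemma IsRealGMeasure.measureReal_dyadic_add (h : IsRealGMeasure c ν) {m M a d : ℕ}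
    (ha : a < 2 ^ m) (hd : d < 2 ^ M) :
    ν.real (dyadic (m + M) (a * 2 ^ M + d)) = ∫ x in dyadic M d, weight c m a x ∂ν := by
  rw [integral_eq_lintegral_of_nonneg_ae (Eventually.of_forall fun x => weight_nonneg _ _ _ _)
    (continuous_weight c m a).aestronglyMeasurable, measureReal_def]
  congr 1
  rw [← lintegral_indicator_one (measurableSet_dyadic _ _), h.lintegral_iterate m
    (measurable_one.indicator (measurableSet_dyadic _ _)),
    Finset.sum_eq_single_of_mem a (Finset.mem_range.2 ha),
    ← lintegral_indicator (measurableSet_dyadic _ _)]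
  · refine lintegral_congr_ae ?_
    filter_upwards [h.ae_mem] with x hx
    by_cases hxd : x ∈ dyadic M d
    · rw [indicator_of_mem hxd, indicator_of_mem ((mem_dyadic_add_iff hd hx).2 ⟨rfl, hxd⟩)]
      simp
    · rw [indicator_of_notMem hxd, indicator_of_notMem fun hh =>
        hxd ((mem_dyadic_add_iff hd hx).1 hh).2, mul_zero]
  · intro k _ hk
    rw [lintegral_eq_zero_iff' (by
      have := (continuous_weight c m k).measurable
      have : Measurable ((dyadic (m + M) (a * 2 ^ M + d)).indicator (1 : ℝ → ℝ≥0∞)) :=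
        measurable_one.indicator (measurableSet_dyadic _ _)
      exact Measurable.aemeasurable (by fun_prop))]
    filter_upwards [h.ae_mem] with x hx
    rw [indicator_of_notMem fun hh => hk ((mem_dyadic_add_iff hd hx).1 hh).1, mul_zero]
    rfl

lemma IsRealGMeasure.measureReal_Ico (h : IsRealGMeasure c ν) : ν.real (Ico 0 1) = 1 := by
  have := h.prob
  rw [measureReal_def, prob_compl_eq_zero_iff measurableSet_Ico |>.1 h.ae_mem]
  simp

lemma IsRealGMeasure.measureReal_dyadic (h : IsRealGMeasure c ν) {m a : ℕ} (ha : a < 2 ^ m) :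
    ν.real (dyadic m a) = ∫ x in Ico 0 1, weight c m a x ∂ν := by
  have := h.measureReal_dyadic_add ha (M := 0) (d := 0) (by norm_num)
  simpa [dyadic_zero] using this

lemma IsRealGMeasure.measureReal_dyadic_add_le (h : IsRealGMeasure c ν) {m M a d : ℕ}
    (ha : a < 2 ^ m) (hd : d < 2 ^ M) {C : ℝ} (hC : ∀ x ∈ dyadic M d, weight c m a x ≤ C) :
    ν.real (dyadic (m + M) (a * 2 ^ M + d)) ≤ C * ν.real (dyadic M d) := by
  have := h.prob
  rw [h.measureReal_dyadic_add ha hd]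
  calc ∫ x in dyadic M d, weight c m a x ∂ν ≤ ∫ _ in dyadic M d, C ∂ν :=
        setIntegral_mono_on (integrable_weight _ _).integrableOn (integrable_const C).integrableOn
          (measurableSet_dyadic _ _) hC
    _ = C * ν.real (dyadic M d) := by simp [mul_comm]

lemma IsRealGMeasure.le_measureReal_dyadic_add (h : IsRealGMeasure c ν) {m M a d : ℕ}
    (ha : a < 2 ^ m) (hd : d < 2 ^ M) {C : ℝ} (hC : ∀ x ∈ dyadic M d, C ≤ weight c m a x) :
    C * ν.real (dyadic M d) ≤ ν.real (dyadic (m + M) (a * 2 ^ M + d)) := by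
  have := h.prob
  rw [h.measureReal_dyadic_add ha hd]
  calc C * ν.real (dyadic M d) = ∫ _ in dyadic M d, C ∂ν := by simp [mul_comm]
    _ ≤ ∫ x in dyadic M d, weight c m a x ∂ν :=
        setIntegral_mono_on (integrable_const C).integrableOn (integrable_weight _ _).integrableOn
          (measurableSet_dyadic _ _) hC

lemma IsRealGMeasure.measureReal_dyadic_le (h : IsRealGMeasure c ν) {m a : ℕ}
    (ha : a < 2 ^ m) {C : ℝ} (hC : ∀ x ∈ Ico (0 : ℝ) 1, weight c m a x ≤ C) :
    ν.real (dyadic m a) ≤ C := by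
  have := h.measureReal_dyadic_add_le ha (M := 0) (d := 0) (by norm_num) (C := C)
    (by simpa [dyadic_zero] using hC)
  simpa [dyadic_zero, h.measureReal_Ico] using this

lemma IsRealGMeasure.sum_measureReal_dyadic_add (h : IsRealGMeasure c ν) (m : ℕ) {M d : ℕ}
    (hd : d < 2 ^ M) :
    ∑ a ∈ Finset.range (2 ^ m), ν.real (dyadic (m + M) (a * 2 ^ M + d)) =
      ν.real (dyadic M d) := by
  have := h.prob
  rw [Finset.sum_congr rfl fun a ha => h.measureReal_dyadic_add (Finset.mem_range.1 ha) hd,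
    ← integral_finsetSum _ fun a _ => (integrable_weight _ _).integrableOn]
  simp [sum_weight]

lemma IsRealGMeasure.sum_measureReal_dyadic (h : IsRealGMeasure c ν) (m : ℕ) :
    ∑ a ∈ Finset.range (2 ^ m), ν.real (dyadic m a) = 1 := by
  have := h.sum_measureReal_dyadic_add m (M := 0) (d := 0) (by norm_num)
  simpa [dyadic_zero, h.measureReal_Ico] using this

end RealGMeasure

/-- The distance to the nearest integer. -/
def distInt (t : ℝ) : ℝ := |t - round t|

lemma two_mul_distInt_le_abs_sin (t : ℝ) : 2 * distInt t ≤ |Real.sin (Real.pi * t)| := by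
  have h1 := abs_sub_round t
  have hpi := Real.pi_pos
  have e : Real.sin (Real.pi * t - round t * Real.pi) =
      (-1) ^ (round t) * Real.sin (Real.pi * t) := Real.sin_sub_int_mul_pi _ _
  have e2 : |Real.sin (Real.pi * t)| = |Real.sin (Real.pi * (t - round t))| := by
    rw [mul_sub, mul_comm Real.pi (round t : ℝ), e, abs_mul]
    simp
  rw [e2]
  refine le_trans (le_of_eq ?_) (Real.mul_abs_le_abs_sin ?_)
  · rw [abs_mul, abs_of_pos hpi, distInt]; field_simp
  · rw [abs_mul, abs_of_pos hpi]; nlinarith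

lemma distInt_two_pow_mul_le (n : ℕ) (w : ℝ) (z : ℤ) :
    distInt (2 ^ n * w - z) ≤ 2 ^ n * distInt w := by
  calc distInt (2 ^ n * w - z) ≤ |2 ^ n * w - z - ((2 ^ n * round w - z : ℤ) : ℝ)| :=
        round_le _ _
    _ = |2 ^ n * (w - round w)| := by push_cast; ring_nf
    _ = 2 ^ n * distInt w := by rw [abs_mul, abs_of_pos (by positivity), distInt]

/-- The square root of the factor `j` of `weight`. -/
def absFactor (c : ℝ) (k j : ℕ) (x : ℝ) : ℝ :=
  |Real.cos (Real.pi * ((x + k) / 2 ^ (j + 1) - c))|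

lemma absFactor_nonneg (c : ℝ) (k j : ℕ) (x : ℝ) : 0 ≤ absFactor c k j x := abs_nonneg _

lemma gReal_eq_absFactor_sq (c : ℝ) (k j : ℕ) (x : ℝ) :
    gReal c ((x + k) / 2 ^ (j + 1)) = absFactor c k j x ^ 2 := by
  rw [gReal, absFactor, sq_abs]

lemma absFactor_le_add (c : ℝ) (k j : ℕ) {x y : ℝ} (hx : x ∈ Ico (0 : ℝ) 1)
    (hy : y ∈ Ico (0 : ℝ) 1) :
    absFactor c k j x ≤ absFactor c k j y + Real.pi / 2 ^ (j + 1) := by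
  have h2 : (0 : ℝ) < 2 ^ (j + 1) := by positivity
  have h := Real.abs_cos_sub_cos_le (Real.pi * ((x + k) / 2 ^ (j + 1) - c))
    (Real.pi * ((y + k) / 2 ^ (j + 1) - c))
  have e : Real.pi * ((x + k) / 2 ^ (j + 1) - c) - Real.pi * ((y + k) / 2 ^ (j + 1) - c) =
      Real.pi / 2 ^ (j + 1) * (x - y) := by ring
  have hxy : |x - y| ≤ 1 := abs_le.2 ⟨by linarith [hx.1, hy.2], by linarith [hx.2, hy.1]⟩
  rw [e, abs_mul, abs_of_pos (div_pos Real.pi_pos h2)] at h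
  have h3 : Real.pi / 2 ^ (j + 1) * |x - y| ≤ Real.pi / 2 ^ (j + 1) :=
    mul_le_of_le_one_right (div_pos Real.pi_pos h2).le hxy
  have h4 := abs_sub_abs_le_abs_sub (Real.cos (Real.pi * ((x + k) / 2 ^ (j + 1) - c)))
    (Real.cos (Real.pi * ((y + k) / 2 ^ (j + 1) - c)))
  unfold absFactor
  linarith

lemma le_absFactor (c : ℝ) (k j : ℕ) (y : ℝ) :
    distInt (y - 2 ^ (j + 1) * (c + 1 / 2)) / 2 ^ (j + 1) ≤ absFactor c k j y := by
  have h2 : (0 : ℝ) < 2 ^ (j + 1) := by positivity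
  set w := (y + k) / 2 ^ (j + 1) - c - 1 / 2 with hw
  have e : absFactor c k j y = |Real.sin (Real.pi * w)| := by
    have : Real.pi * w = Real.pi * ((y + k) / 2 ^ (j + 1) - c) - Real.pi / 2 := by
      rw [hw]; ring
    rw [this, Real.sin_sub_pi_div_two, abs_neg, absFactor]
  have h3 := distInt_two_pow_mul_le (j + 1) w k
  have e2 : 2 ^ (j + 1) * w - ((k : ℤ) : ℝ) = y - 2 ^ (j + 1) * (c + 1 / 2) := by
    rw [hw]; push_cast; field_simp; ring
  rw [e2] at h3
  rw [e, div_le_iff₀ h2]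
  have h4 := two_mul_distInt_le_abs_sin w
  have h5 : 0 ≤ distInt w := abs_nonneg _
  nlinarith

/-- The points at distance at least `2⁻ᴸ` modulo `1` from the zeros of all the factors of
`weight c m a`. -/
def AwayFromZeros (c : ℝ) (m L : ℕ) (y : ℝ) : Prop :=
  ∀ j < m, 1 / 2 ^ L ≤ distInt (y - 2 ^ (j + 1) * (c + 1 / 2))

open Classical in
lemma card_not_awayFromZeros_le (c : ℝ) (m L : ℕ) :
    ((Finset.range (2 ^ L)).filter fun b =>
      ¬ ∀ y ∈ dyadic L b, AwayFromZeros c m L y).card ≤ 3 * m := by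
  set s : ℕ → ℝ := fun j => 2 ^ (j + 1) * (c + 1 / 2) with hs
  have h2 : (0 : ℝ) < 2 ^ L := by positivity
  calc _ ≤ ((Finset.range m ×ˢ Finset.Icc (-1 : ℤ) 1).image fun p =>
        ((⌊2 ^ L * s p.1⌋ + p.2) % 2 ^ L).toNat).card := by
        refine Finset.card_le_card fun b hb => ?_
        obtain ⟨hb1, hb2⟩ := Finset.mem_filter.1 hb
        rw [Finset.mem_range] at hb1
        simp only [AwayFromZeros, not_forall, not_le] at hb2
        obtain ⟨y, hy, j, hj, hlt⟩ := hb2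
        rw [mem_dyadic_iff] at hy
        set i := round (y - 2 ^ (j + 1) * (c + 1 / 2)) with hi
        rw [distInt, ← hi, lt_div_iff₀ h2, ← abs_of_pos h2, ← abs_mul, abs_lt] at hlt
        have hlt' : -1 < 2 ^ L * y - 2 ^ L * s j - 2 ^ L * i ∧
            2 ^ L * y - 2 ^ L * s j - 2 ^ L * i < 1 := by
          simp only [hs]; constructor <;> linarith [hlt.1, hlt.2]
        have f1 := Int.floor_le (2 ^ L * s j)
        have f2 := Int.lt_floor_add_one (2 ^ L * s j)
        set F := ⌊2 ^ L * s j⌋ with hF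
        have g1 : (b : ℤ) - 2 ^ L * i < F + 2 := by
          have : ((b : ℤ) - 2 ^ L * i : ℝ) < F + 2 := by push_cast; linarith [hlt'.2, hy.1]
          exact_mod_cast this
        have g2 : F - 2 < (b : ℤ) - 2 ^ L * i := by
          have : (F : ℝ) - 2 < ((b : ℤ) - 2 ^ L * i : ℝ) := by push_cast; linarith [hlt'.1, hy.2]
          exact_mod_cast this
        refine Finset.mem_image.2 ⟨(j, (b : ℤ) - 2 ^ L * i - F), ?_, ?_⟩
        · simp only [Finset.mem_product, Finset.mem_range, Finset.mem_Icc]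
          exact ⟨hj, by omega, by omega⟩
        · have hb3 : (b : ℤ) < 2 ^ L := by exact_mod_cast hb1
          simp only [← hF, add_sub_cancel]
          rw [Int.sub_mul_emod_self_left, Int.emod_eq_of_lt (by positivity) hb3, Int.toNat_natCast]
    _ ≤ (Finset.range m ×ˢ Finset.Icc (-1 : ℤ) 1).card := Finset.card_image_le
    _ = 3 * m := by simp [mul_comm]

lemma exists_weight_two_le {c : ℝ} (hc : c ∈ Ioo (0 : ℝ) 1) :
    ∃ θ : ℝ, 0 < θ ∧ θ < 1 ∧ ∀ t, gReal c (2 * t) * gReal c t ≤ θ := by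
  set f : ℝ → ℝ := fun t => gReal c (2 * t) * gReal c t with hf
  have hcont : Continuous f := by
    have := continuous_gReal c
    exact (this.comp (continuous_const.mul continuous_id)).mul this
  have hper : Function.Periodic f 1 := fun t => by
    simp only [hf, gReal_add_one]
    rw [show 2 * (t + 1) = 2 * t + (2 : ℕ) by push_cast; ring, gReal_add_nat]
  obtain ⟨t₀, -, hmax⟩ := (isCompact_Icc (a := (0 : ℝ)) (b := 1)).exists_isMaxOn
    (by simp) hcont.continuousOn
  have hinteg : ∀ t, gReal c t = 1 → ∃ n : ℤ, t - c = n := by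
    intro t ht
    rw [gReal] at ht
    have hs : Real.sin (Real.pi * (t - c)) = 0 := by
      have := Real.sin_sq_add_cos_sq (Real.pi * (t - c))
      rw [ht] at this
      exact pow_eq_zero_iff (two_ne_zero) |>.1 (by linarith)
    obtain ⟨n, hn⟩ := Real.sin_eq_zero_iff.1 hs
    exact ⟨n, by have := Real.pi_ne_zero; field_simp at hn; linarith⟩
  have hlt : f t₀ < 1 := by
    have a1 := gReal_le_one c (2 * t₀)
    have a2 := gReal_le_one c t₀
    have a3 := gReal_nonneg c (2 * t₀)
    have a4 := gReal_nonneg c t₀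
    by_contra hcon
    have hge : 1 ≤ gReal c (2 * t₀) * gReal c t₀ := not_lt.1 hcon
    obtain ⟨n, hn⟩ := hinteg (2 * t₀) (by nlinarith)
    obtain ⟨k, hk⟩ := hinteg t₀ (by nlinarith)
    have h1 : c = ((n - 2 * k : ℤ) : ℝ) := by push_cast; linarith
    have h2 := hc.1
    have h3 := hc.2
    rw [h1] at h2 h3
    have h2' : 0 < n - 2 * k := by exact_mod_cast h2
    have h3' : n - 2 * k < 1 := by exact_mod_cast h3
    omega
  refine ⟨max (1 / 2) (f t₀), lt_max_of_lt_left (by norm_num), max_lt (by norm_num) hlt,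
    fun t => ?_⟩
  obtain ⟨y, hy, hty⟩ := hper.exists_mem_Ico₀ one_pos t
  calc f t = f y := hty
    _ ≤ f t₀ := hmax (Ico_subset_Icc_self hy)
    _ ≤ _ := le_max_right _ _

lemma weight_two_mul_le {c θ : ℝ} (hθ : ∀ t, gReal c (2 * t) * gReal c t ≤ θ) (h0 : 0 < θ)
    (l b : ℕ) (x : ℝ) : weight c (2 * l) b x ≤ θ ^ l := by
  induction l with
  | zero => simp [weight]
  | succ l ih =>
    have h := hθ ((x + b) / 2 ^ (2 * l + 1 + 1))
    have e : 2 * ((x + b) / 2 ^ (2 * l + 1 + 1)) = (x + b) / 2 ^ (2 * l + 1) := by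
      rw [pow_succ _ (2 * l + 1)]; field_simp
    rw [e] at h
    have e2 : weight c (2 * (l + 1)) b x = weight c (2 * l) b x *
        (gReal c ((x + b) / 2 ^ (2 * l + 1)) * gReal c ((x + b) / 2 ^ (2 * l + 1 + 1))) := by
      simp only [weight]
      rw [mul_add, mul_one, Finset.prod_range_succ, Finset.prod_range_succ, mul_assoc]
    rw [e2, pow_succ]
    exact mul_le_mul ih h (mul_nonneg (gReal_nonneg _ _) (gReal_nonneg _ _)) (pow_nonneg h0.le l)

open Classical in
/-- The factors of `weight c m a` which come close to zero on the scale of their variation. -/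
def nearZero (c K : ℝ) (m a : ℕ) : Finset ℕ :=
  (Finset.range m).filter fun j => ∃ x ∈ Ico (0 : ℝ) 1, absFactor c a j x < K / 2 ^ (j + 1)

lemma mem_nearZero {c K : ℝ} {m a j : ℕ} : j ∈ nearZero c K m a ↔
    j < m ∧ ∃ x ∈ Ico (0 : ℝ) 1, absFactor c a j x < K / 2 ^ (j + 1) := by
  simp [nearZero]

lemma weight_le_weight_mul {c K : ℝ} (hK : 0 < K) {m a L : ℕ} {x y : ℝ}
    (hx : x ∈ Ico (0 : ℝ) 1) (hy : y ∈ Ico (0 : ℝ) 1) (hay : AwayFromZeros c m L y) :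
    weight c m a x ≤ weight c m a y *
      (((1 + Real.pi / K) ^ m * (1 + Real.pi * 2 ^ L) ^ (nearZero c K m a).card) ^ 2) := by
  classical
  have hpi := Real.pi_pos
  set ρ : ℕ → ℝ := fun j => (1 + Real.pi / K) *
    (if ∃ x ∈ Ico (0 : ℝ) 1, absFactor c a j x < K / 2 ^ (j + 1)
      then 1 + Real.pi * 2 ^ L else 1) with hρ
  have hprod : ∏ j ∈ Finset.range m, ρ j =
      (1 + Real.pi / K) ^ m * (1 + Real.pi * 2 ^ L) ^ (nearZero c K m a).card := by
    rw [Finset.prod_mul_distrib, Finset.prod_const, Finset.card_range, ← Finset.prod_filter,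
      Finset.prod_const]
    rfl
  rw [← hprod, weight, weight, ← Finset.prod_pow, ← Finset.prod_mul_distrib]
  refine Finset.prod_le_prod (fun j _ => gReal_nonneg _ _) fun j hj => ?_
  rw [gReal_eq_absFactor_sq, gReal_eq_absFactor_sq, ← mul_pow]
  refine pow_le_pow_left₀ (absFactor_nonneg _ _ _ _) ?_ 2
  have h2 : (0 : ℝ) < 2 ^ (j + 1) := by positivity
  have hL : (0 : ℝ) < 2 ^ L := by positivity
  have h1 := absFactor_le_add c a j hx hy
  have h0 := absFactor_nonneg c a j y
  have hK1 : 1 ≤ 1 + Real.pi / K := by have := div_pos hpi hK; linarith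
  by_cases hn : ∃ x ∈ Ico (0 : ℝ) 1, absFactor c a j x < K / 2 ^ (j + 1)
  · have h3 : 1 / 2 ^ L / 2 ^ (j + 1) ≤ absFactor c a j y :=
      (div_le_div_of_nonneg_right (hay j (Finset.mem_range.1 hj)) h2.le).trans
        (le_absFactor c a j y)
    have h4 : Real.pi / 2 ^ (j + 1) ≤ absFactor c a j y * (Real.pi * 2 ^ L) := by
      calc Real.pi / 2 ^ (j + 1) = 1 / 2 ^ L / 2 ^ (j + 1) * (Real.pi * 2 ^ L) := by
            field_simp
        _ ≤ _ := mul_le_mul_of_nonneg_right h3 (by positivity)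
    simp only [hρ, if_pos hn]
    calc absFactor c a j x ≤ absFactor c a j y * (1 * (1 + Real.pi * 2 ^ L)) := by linarith
      _ ≤ _ := by gcongr
  · have h3 : K / 2 ^ (j + 1) ≤ absFactor c a j y := by
      by_contra hcon
      exact hn ⟨y, hy, not_le.1 hcon⟩
    have h4 : Real.pi / 2 ^ (j + 1) ≤ absFactor c a j y * (Real.pi / K) := by
      calc Real.pi / 2 ^ (j + 1) = K / 2 ^ (j + 1) * (Real.pi / K) := by field_simp
        _ ≤ _ := mul_le_mul_of_nonneg_right h3 (by positivity)
    simp only [hρ, if_neg hn]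
    linarith

lemma IsRealGMeasure.measureReal_dyadic_le_nearZero {c : ℝ} {ν : Measure ℝ}
    (h : IsRealGMeasure c ν) {K : ℝ} {s : ℕ} (hs : (K + Real.pi) ^ 2 ≤ 2 ^ s)
    {m a : ℕ} (ha : a < 2 ^ m) :
    ν.real (dyadic m a) ≤ (1 / 2) ^ (s * ((nearZero c K m a).card - s)) := by
  have hpi := Real.pi_pos
  refine h.measureReal_dyadic_le ha fun x hx => ?_
  set J' := (nearZero c K m a).filter fun j => s ≤ j with hJ'
  have hcard : (nearZero c K m a).card - s ≤ J'.card := by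
    have h1 : ((nearZero c K m a).filter fun j => ¬ s ≤ j).card ≤ s := by
      calc _ ≤ (Finset.range s).card := Finset.card_le_card fun j hj => by
            have := (Finset.mem_filter.1 hj).2
            exact Finset.mem_range.2 (not_le.1 this)
        _ = s := Finset.card_range s
    have h2 := Finset.card_filter_add_card_filter_not (s := nearZero c K m a) (fun j => s ≤ j)
    rw [← hJ'] at h2
    omega
  have hsub : J' ⊆ Finset.range m :=
    fun j hj => Finset.mem_range.2 (mem_nearZero.1 (Finset.mem_filter.1 hj).1).1
  calc weight c m a x ≤ ∏ j ∈ J', gReal c ((x + a) / 2 ^ (j + 1)) :=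
        Finset.prod_le_prod_of_subset_of_le_one hsub (fun _ _ => gReal_nonneg _ _)
          fun _ _ _ => gReal_le_one _ _
    _ ≤ ∏ _j ∈ J', (1 / 2 : ℝ) ^ s := by
        refine Finset.prod_le_prod (fun j _ => gReal_nonneg _ _) fun j hj => ?_
        obtain ⟨hj1, hj2⟩ := Finset.mem_filter.1 hj
        obtain ⟨-, y, hy, hlt⟩ := mem_nearZero.1 hj1
        have h2 : (0 : ℝ) < 2 ^ (j + 1) := by positivity
        have h1 : absFactor c a j x ≤ (K + Real.pi) / 2 ^ (j + 1) := by
          have := absFactor_le_add c a j hx hy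
          rw [add_div]; linarith
        rw [gReal_eq_absFactor_sq]
        calc absFactor c a j x ^ 2 ≤ ((K + Real.pi) / 2 ^ (j + 1)) ^ 2 :=
              pow_le_pow_left₀ (absFactor_nonneg _ _ _ _) h1 2
          _ = (K + Real.pi) ^ 2 / 2 ^ (2 * (j + 1)) := by
              rw [div_pow, ← pow_mul, mul_comm (j + 1)]
          _ ≤ 2 ^ s / 2 ^ (2 * s) := by
              gcongr
              · norm_num
              · omega
          _ = (1 / 2) ^ s := by
              rw [two_mul, pow_add, div_pow, one_pow]; field_simp
    _ = (1 / 2) ^ (s * J'.card) := by rw [Finset.prod_const, ← pow_mul]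
    _ ≤ _ := pow_le_pow_of_le_one (by norm_num) (by norm_num) (Nat.mul_le_mul_left s hcard)

lemma dyadic_add_subset {L N b d : ℕ} (hd : d < 2 ^ N) :
    dyadic (L + N) (b * 2 ^ N + d) ⊆ dyadic L b := by
  intro x hx
  rw [mem_dyadic_iff] at hx ⊢
  have hd' : (d : ℝ) + 1 ≤ 2 ^ N := by exact_mod_cast hd
  have hd0 : (0 : ℝ) ≤ d := Nat.cast_nonneg d
  have h2 : (0 : ℝ) < 2 ^ N := by positivity
  rw [pow_add] at hx
  push_cast at hx
  constructor
  · refine le_of_mul_le_mul_left ?_ h2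
    linarith [hx.1]
  · refine lt_of_mul_lt_mul_left ?_ h2.le
    linarith [hx.2]

lemma mul_two_pow_add_lt {L N b d : ℕ} (hb : b < 2 ^ L) (hd : d < 2 ^ N) :
    b * 2 ^ N + d < 2 ^ (L + N) := by
  have : (b + 1) * 2 ^ N ≤ 2 ^ L * 2 ^ N := Nat.mul_le_mul_right _ hb
  rw [pow_add]
  linarith [add_mul b 1 (2 ^ N)]

lemma IsRealGMeasure.exists_connecting {c : ℝ} {ν : Measure ℝ} (h : IsRealGMeasure c ν) {θ : ℝ}
    (h0 : 0 < θ) (hθ : ∀ t, gReal c (2 * t) * gReal c t ≤ θ) {m l : ℕ}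
    (hml : 3 * m * θ ^ l ≤ 1 / 2) {N d : ℕ} (hd : d < 2 ^ N) (hpos : 0 < ν.real (dyadic N d)) :
    ∃ b < 2 ^ (2 * l), (∀ y ∈ dyadic (2 * l) b, AwayFromZeros c m (2 * l) y) ∧
      ν.real (dyadic N d) / 2 ^ (2 * l + 1) ≤
        ν.real (dyadic (2 * l + N) (b * 2 ^ N + d)) := by
  classical
  set P : ℕ → ℝ := fun b => ν.real (dyadic (2 * l + N) (b * 2 ^ N + d)) with hP
  set p := ν.real (dyadic N d)
  set good : ℕ → Prop := fun b => ∀ y ∈ dyadic (2 * l) b, AwayFromZeros c m (2 * l) y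
  have hsum : ∑ b ∈ Finset.range (2 ^ (2 * l)), P b = p :=
    h.sum_measureReal_dyadic_add (2 * l) hd
  have hbad : ∑ b ∈ (Finset.range (2 ^ (2 * l))).filter (fun b => ¬ good b), P b ≤ p / 2 := by
    have hcard : (((Finset.range (2 ^ (2 * l))).filter (fun b => ¬ good b)).card : ℝ) ≤ 3 * m := by
      exact_mod_cast card_not_awayFromZeros_le c m (2 * l)
    calc _ ≤ ∑ _b ∈ (Finset.range (2 ^ (2 * l))).filter (fun b => ¬ good b), θ ^ l * p :=
          Finset.sum_le_sum fun b hb => h.measureReal_dyadic_add_le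
            (Finset.mem_range.1 (Finset.mem_filter.1 hb).1) hd
            fun x _ => weight_two_mul_le hθ h0 l b x
      _ = ((Finset.range (2 ^ (2 * l))).filter (fun b => ¬ good b)).card * (θ ^ l * p) := by
          rw [Finset.sum_const, nsmul_eq_mul]
      _ ≤ 3 * m * (θ ^ l * p) := by gcongr
      _ = 3 * m * θ ^ l * p := by ring
      _ ≤ 1 / 2 * p := by gcongr
      _ = p / 2 := by ring
  have hgood : p / 2 ≤ ∑ b ∈ (Finset.range (2 ^ (2 * l))).filter good, P b := by
    have := Finset.sum_filter_add_sum_filter_not (Finset.range (2 ^ (2 * l))) good P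
    linarith
  by_contra! hcon
  have hne : ((Finset.range (2 ^ (2 * l))).filter good).Nonempty := by
    rw [Finset.nonempty_iff_ne_empty]
    intro he
    rw [he, Finset.sum_empty] at hgood
    linarith
  have hlt : ∑ b ∈ (Finset.range (2 ^ (2 * l))).filter good, P b <
      ∑ _b ∈ (Finset.range (2 ^ (2 * l))).filter good, p / 2 ^ (2 * l + 1) :=
    Finset.sum_lt_sum_of_nonempty hne fun b hb =>
      hcon b (Finset.mem_range.1 (Finset.mem_filter.1 hb).1) (Finset.mem_filter.1 hb).2
  rw [Finset.sum_const, nsmul_eq_mul] at hlt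
  have hc : (((Finset.range (2 ^ (2 * l))).filter good).card : ℝ) ≤ 2 ^ (2 * l) := by
    have := Finset.card_filter_le (Finset.range (2 ^ (2 * l))) good
    rw [Finset.card_range] at this
    exact_mod_cast this
  have : (((Finset.range (2 ^ (2 * l))).filter good).card : ℝ) * (p / 2 ^ (2 * l + 1)) ≤ p / 2 := by
    calc _ ≤ (2 : ℝ) ^ (2 * l) * (p / 2 ^ (2 * l + 1)) := by gcongr
      _ = p / 2 := by rw [pow_succ]; field_simp
  linarith

lemma IsRealGMeasure.exists_glue {c : ℝ} {ν : Measure ℝ} (h : IsRealGMeasure c ν) {θ : ℝ}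
    (h0 : 0 < θ) (hθ : ∀ t, gReal c (2 * t) * gReal c t ≤ θ) {m l : ℕ}
    (hml : 3 * m * θ ^ l ≤ 1 / 2) {K : ℝ} (hK : 0 < K) {a : ℕ} (ha : a < 2 ^ m)
    {N d : ℕ} (hd : d < 2 ^ N) (hpos : 0 < ν.real (dyadic N d)) :
    ∃ b < 2 ^ (2 * l), ν.real (dyadic m a) * ν.real (dyadic N d) ≤
      ν.real (dyadic (m + (2 * l + N)) (a * 2 ^ (2 * l + N) + (b * 2 ^ N + d))) *
        (2 ^ (2 * l + 1) * ((1 + Real.pi / K) ^ m *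
          (1 + Real.pi * 2 ^ (2 * l)) ^ (nearZero c K m a).card) ^ 2) := by
  have hpi := Real.pi_pos
  obtain ⟨b, hb, haway, hconn⟩ := h.exists_connecting h0 hθ hml hd hpos
  refine ⟨b, hb, ?_⟩
  set R := ((1 + Real.pi / K) ^ m *
    (1 + Real.pi * 2 ^ (2 * l)) ^ (nearZero c K m a).card) ^ 2 with hR
  have hRpos : 0 < R := by positivity
  have hbd := mul_two_pow_add_lt hb hd
  have hlow : ∀ y ∈ dyadic (2 * l + N) (b * 2 ^ N + d), ν.real (dyadic m a) / R ≤
      weight c m a y := fun y hy => by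
    rw [div_le_iff₀ hRpos]
    exact h.measureReal_dyadic_le ha fun x hx =>
      weight_le_weight_mul hK hx (dyadic_subset hbd hy) (haway y (dyadic_add_subset hd hy))
  have h1 := h.le_measureReal_dyadic_add ha hbd hlow
  have h2 : (0 : ℝ) < 2 ^ (2 * l + 1) := by positivity
  rw [div_le_iff₀ h2] at hconn
  calc _ ≤ ν.real (dyadic m a) *
        (ν.real (dyadic (2 * l + N) (b * 2 ^ N + d)) * 2 ^ (2 * l + 1)) := by
        gcongr
    _ = ν.real (dyadic m a) / R * ν.real (dyadic (2 * l + N) (b * 2 ^ N + d)) *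
        (2 ^ (2 * l + 1) * R) := by field_simp
    _ ≤ _ := by gcongr

lemma tendsto_sqrt_sqrt : Tendsto (fun m : ℕ => Nat.sqrt (Nat.sqrt m)) atTop atTop := by
  have : Tendsto Nat.sqrt atTop atTop := by
    refine tendsto_atTop.2 fun b => ?_
    filter_upwards [eventually_ge_atTop (b * b)] with m hm
    exact Nat.le_sqrt.2 hm
  exact this.comp this

lemma sqrt_sqrt_bounds (m : ℕ) :
    Nat.sqrt (Nat.sqrt m) ^ 4 ≤ m ∧ m ≤ (Nat.sqrt (Nat.sqrt m) + 1) ^ 4 := by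
  have h1 := Nat.sqrt_le' (Nat.sqrt m)
  have h2 := Nat.sqrt_le' m
  have h3 := Nat.lt_succ_sqrt' (Nat.sqrt m)
  have h4 := Nat.lt_succ_sqrt' m
  simp only [Nat.succ_eq_add_one] at h3 h4
  constructor
  · calc _ = (Nat.sqrt (Nat.sqrt m) ^ 2) ^ 2 := by ring
      _ ≤ Nat.sqrt m ^ 2 := Nat.pow_le_pow_left h1 2
      _ ≤ m := h2
  · calc m ≤ (Nat.sqrt m + 1) ^ 2 := h4.le
      _ ≤ ((Nat.sqrt (Nat.sqrt m) + 1) ^ 2) ^ 2 := Nat.pow_le_pow_left h3 2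
      _ = _ := by ring

lemma eventually_mul_pow_sqrt_sqrt_le {θ : ℝ} (h0 : 0 < θ) (h1 : θ < 1) :
    ∀ᶠ m : ℕ in atTop, 3 * (m : ℝ) * θ ^ Nat.sqrt (Nat.sqrt m) ≤ 1 / 2 := by
  have ht := (tendsto_pow_const_mul_const_pow_of_abs_lt_one 4
    (by rwa [abs_of_pos h0] : |θ| < 1)).comp tendsto_sqrt_sqrt
  filter_upwards [ht.eventually (gt_mem_nhds (by norm_num : (0 : ℝ) < 1 / 96)),
    tendsto_sqrt_sqrt.eventually_ge_atTop 1] with m hm h1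
  set l := Nat.sqrt (Nat.sqrt m)
  have hb : (m : ℝ) ≤ (l + 1) ^ 4 := by exact_mod_cast (sqrt_sqrt_bounds m).2
  have hl : (1 : ℝ) ≤ l := by exact_mod_cast h1
  have hb2 : ((l : ℝ) + 1) ^ 4 ≤ 16 * (l : ℝ) ^ 4 := by
    calc ((l : ℝ) + 1) ^ 4 ≤ (2 * l) ^ 4 := by gcongr; linarith
      _ = 16 * (l : ℝ) ^ 4 := by ring
  simp only [Function.comp] at hm
  calc 3 * (m : ℝ) * θ ^ l ≤ 3 * (16 * (l : ℝ) ^ 4) * θ ^ l := by gcongr; exact hb.trans hb2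
    _ = 48 * ((l : ℝ) ^ 4 * θ ^ l) := by ring
    _ ≤ 1 / 2 := by linarith

/-- Supermultiplicativity of the cylinder masses up to a subexponential error and a connecting word
of sublinear length. -/
lemma IsRealGMeasure.eventually_glue {c : ℝ} {ν : Measure ℝ} (h : IsRealGMeasure c ν)
    (hc : c ∈ Ioo (0 : ℝ) 1) {ε A : ℝ} (hε : 0 < ε) (hA : 0 < A) :
    ∀ᶠ m : ℕ in atTop, ∃ L : ℕ, (L : ℝ) ≤ ε * m ∧
      ∀ a < 2 ^ m, (2 : ℝ) ^ (-(A * m)) ≤ ν.real (dyadic m a) →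
        ∀ N d, d < 2 ^ N → 0 < ν.real (dyadic N d) → ∃ b < 2 ^ L,
          (2 : ℝ) ^ (-(ε * m)) * ν.real (dyadic m a) * ν.real (dyadic N d) ≤
            ν.real (dyadic (m + (L + N)) (a * 2 ^ (L + N) + (b * 2 ^ N + d))) := by
  obtain ⟨θ, h0, h1, hθ⟩ := exists_weight_two_le hc
  have hpi := Real.pi_pos
  have hε4 : 1 < (2 : ℝ) ^ (ε / 4) := Real.one_lt_rpow (by norm_num) (by linarith)
  set K := Real.pi / (2 ^ (ε / 4) - 1) with hK
  have hKpos : 0 < K := div_pos hpi (by linarith)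
  have hKe : 1 + Real.pi / K = 2 ^ (ε / 4) := by rw [hK]; field_simp; ring
  filter_upwards [eventually_mul_pow_sqrt_sqrt_le h0 h1, tendsto_sqrt_sqrt.eventually_ge_atTop 1,
    tendsto_sqrt_sqrt.eventually_ge_atTop ⌈K + Real.pi⌉₊,
    tendsto_sqrt_sqrt.eventually_ge_atTop ⌈2 * (10 * (A + 1) + 3) / ε⌉₊] with m hm hl1 hl2 hl3
  obtain ⟨hb, -⟩ := sqrt_sqrt_bounds m
  set l := Nat.sqrt (Nat.sqrt m)
  have hl1' : (1 : ℝ) ≤ l := by exact_mod_cast hl1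
  have hl2' : K + Real.pi ≤ l := Nat.ceil_le.1 hl2
  have hl3' : 2 * (10 * (A + 1) + 3) / ε ≤ l := Nat.ceil_le.1 hl3
  have hb' : (l : ℝ) ^ 4 ≤ m := by exact_mod_cast hb
  have hml : (10 * (A + 1) + 3) * (m / l) ≤ ε * m / 2 := by
    rw [div_le_iff₀ hε] at hl3'
    rw [mul_div_assoc', div_le_iff₀ (by linarith)]
    nlinarith [Nat.cast_nonneg (α := ℝ) m]
  have hlm : (l : ℝ) ≤ m / l := by
    rw [le_div_iff₀ (by linarith)]
    nlinarith [one_le_pow₀ hl1' (n := 2)]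
  have hm0 : (0 : ℝ) ≤ m := Nat.cast_nonneg m
  refine ⟨2 * l, ?_, fun a ha hpa N d hd hpos => ?_⟩
  · push_cast
    nlinarith
  · obtain ⟨b, hb, hle⟩ := h.exists_glue h0 hθ hm hKpos ha hd hpos
    refine ⟨b, hb, ?_⟩
    set n := (nearZero c K m a).card with hn
    have hs : (K + Real.pi) ^ 2 ≤ (2 : ℝ) ^ (l ^ 2) := by
      calc (K + Real.pi) ^ 2 ≤ (l : ℝ) ^ 2 := by gcongr
        _ ≤ 2 ^ (l ^ 2) := by exact_mod_cast (Nat.lt_two_pow_self (n := l ^ 2)).le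
    have hcard : ((l : ℝ) ^ 2) * n ≤ (A + 1) * m := by
      have h3 := hpa.trans (h.measureReal_dyadic_le_nearZero hs ha)
      have h4 : ((1 : ℝ) / 2) ^ (l ^ 2 * (n - l ^ 2)) =
          2 ^ (-((l ^ 2 * (n - l ^ 2) : ℕ) : ℝ)) := by
        rw [Real.rpow_neg (by norm_num), Real.rpow_natCast, one_div, inv_pow]
      rw [← hn, h4, Real.rpow_le_rpow_left_iff (by norm_num)] at h3
      have h5 : l ^ 2 * n ≤ l ^ 2 * (n - l ^ 2) + l ^ 4 := by
        have : n ≤ (n - l ^ 2) + l ^ 2 := by omega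
        calc l ^ 2 * n ≤ l ^ 2 * ((n - l ^ 2) + l ^ 2) := Nat.mul_le_mul_left _ this
          _ = _ := by ring
      have h6 : (l : ℝ) ^ 2 * n ≤ ((l ^ 2 * (n - l ^ 2) : ℕ) : ℝ) + l ^ 4 := by exact_mod_cast h5
      linarith
    have hln : (l : ℝ) * n ≤ (A + 1) * (m / l) := by
      rw [mul_div_assoc', le_div_iff₀ (by linarith)]
      linarith
    have hR : (2 : ℝ) ^ (2 * l + 1) * ((1 + Real.pi / K) ^ m *
        (1 + Real.pi * 2 ^ (2 * l)) ^ n) ^ 2 ≤ 2 ^ (ε * m) := by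
      have e1 : 1 + Real.pi * 2 ^ (2 * l) ≤ (2 : ℝ) ^ (2 * l + 3) := by
        have : (1 : ℝ) ≤ 2 ^ (2 * l) := one_le_pow₀ (by norm_num)
        rw [pow_add]
        nlinarith [Real.pi_lt_four]
      calc _ ≤ (2 : ℝ) ^ (2 * l + 1) * ((2 ^ (ε / 4)) ^ m * (2 ^ (2 * l + 3)) ^ n) ^ 2 := by
            rw [hKe]; gcongr
        _ = 2 ^ (ε * m / 2) * 2 ^ (((2 * l + 3) * n * 2 + (2 * l + 1) : ℕ) : ℝ) := by
            rw [mul_pow, ← Real.rpow_natCast (2 ^ (ε / 4)), ← Real.rpow_mul (by norm_num),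
              ← Real.rpow_natCast (2 ^ (ε / 4 * m)), ← Real.rpow_mul (by norm_num),
              Real.rpow_natCast, ← pow_mul, ← pow_mul, pow_add _ ((2 * l + 3) * n * 2)]
            rw [show ε / 4 * m * (2 : ℕ) = ε * m / 2 by push_cast; ring]
            ring
        _ ≤ 2 ^ (ε * m / 2) * 2 ^ (ε * m / 2) := by
            gcongr
            · norm_num
            · push_cast
              have hn0 : (0 : ℝ) ≤ n := Nat.cast_nonneg n
              nlinarith
        _ = 2 ^ (ε * m) := by rw [← Real.rpow_add (by norm_num)]; ring_nf
    rw [Real.rpow_neg (by norm_num), mul_assoc, ← div_eq_inv_mul,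
      div_le_iff₀ (Real.rpow_pos_of_pos (by norm_num) _)]
    exact hle.trans (mul_le_mul_of_nonneg_left hR measureReal_nonneg)

lemma IsRealGMeasure.exists_chain {c : ℝ} {ν : Measure ℝ} (h : IsRealGMeasure c ν) {m L : ℕ}
    {W : Finset ℕ} {s : ℝ} (hs : 0 < s) (hW : ∀ a ∈ W, a < 2 ^ m)
    (glue : ∀ a ∈ W, ∀ N d, d < 2 ^ N → 0 < ν.real (dyadic N d) → ∃ b < 2 ^ L,
      s * ν.real (dyadic N d) ≤
        ν.real (dyadic (m + (L + N)) (a * 2 ^ (L + N) + (b * 2 ^ N + d)))) (k : ℕ) :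
    ∃ V : Finset ℕ, (∀ v ∈ V, v < 2 ^ (k * (m + L))) ∧ W.card ^ k ≤ V.card ∧
      ∀ v ∈ V, s ^ k ≤ ν.real (dyadic (k * (m + L)) v) := by
  induction k with
  | zero =>
    refine ⟨{0}, by simp, by simp, ?_⟩
    simp [dyadic_zero, h.measureReal_Ico]
  | succ k ih =>
    obtain ⟨V, hV, hcard, hP⟩ := ih
    have hpos : ∀ v ∈ V, 0 < ν.real (dyadic (k * (m + L)) v) := fun v hv =>
      lt_of_lt_of_le (pow_pos hs k) (hP v hv)
    have glue' : ∀ p : ℕ × ℕ, ∃ b, p ∈ W ×ˢ V → b < 2 ^ L ∧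
        s * ν.real (dyadic (k * (m + L)) p.2) ≤ ν.real (dyadic (m + (L + k * (m + L)))
          (p.1 * 2 ^ (L + k * (m + L)) + (b * 2 ^ (k * (m + L)) + p.2))) := by
      intro p
      by_cases hp : p ∈ W ×ˢ V
      · obtain ⟨b, hb⟩ := glue p.1 (Finset.mem_product.1 hp).1 _ p.2
          (hV _ (Finset.mem_product.1 hp).2) (hpos _ (Finset.mem_product.1 hp).2)
        exact ⟨b, fun _ => hb⟩
      · exact ⟨0, fun hh => absurd hh hp⟩
    choose β hβ using glue'
    set M := k * (m + L) with hM
    have hlev : (k + 1) * (m + L) = m + (L + M) := by rw [hM]; ring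
    have hlow : ∀ p ∈ W ×ˢ V, β p * 2 ^ M + p.2 < 2 ^ (L + M) := fun p hp =>
      mul_two_pow_add_lt (hβ p hp).1 (hV _ (Finset.mem_product.1 hp).2)
    refine ⟨(W ×ˢ V).image fun p => p.1 * 2 ^ (L + M) + (β p * 2 ^ M + p.2), ?_, ?_, ?_⟩
    · intro v hv
      obtain ⟨p, hp, rfl⟩ := Finset.mem_image.1 hv
      rw [hlev]
      exact mul_two_pow_add_lt (hW _ (Finset.mem_product.1 hp).1) (hlow p hp)
    · rw [Finset.card_image_of_injOn, Finset.card_product, pow_succ, mul_comm]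
      · exact Nat.mul_le_mul_left _ hcard
      · intro p hp p' hp' hpp
        have hp := Finset.mem_coe.1 hp
        have hp' := Finset.mem_coe.1 hp'
        simp only at hpp
        have e1 : p.1 = p'.1 := by
          have := congrArg (· / 2 ^ (L + M)) hpp
          simpa [Nat.mul_add_div, mul_comm _ (2 ^ (L + M)), Nat.div_eq_of_lt (hlow p hp),
            Nat.div_eq_of_lt (hlow p' hp')] using this
        have e2 : p.2 = p'.2 := by
          rw [e1] at hpp
          have := congrArg (· % 2 ^ M) (Nat.add_left_cancel hpp)
          simpa [Nat.mul_add_mod, mul_comm _ (2 ^ M),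
            Nat.mod_eq_of_lt (hV _ (Finset.mem_product.1 hp).2),
            Nat.mod_eq_of_lt (hV _ (Finset.mem_product.1 hp').2)] using this
        exact Prod.ext e1 e2
    · intro v hv
      obtain ⟨p, hp, rfl⟩ := Finset.mem_image.1 hv
      rw [hlev, pow_succ, mul_comm]
      exact (mul_le_mul_of_nonneg_left (hP _ (Finset.mem_product.1 hp).2) hs.le).trans
        (hβ p hp).2

lemma eventually_mul_add_le_rpow {A B τ : ℝ} (hτ : 0 < τ) :
    ∀ᶠ m : ℕ in atTop, A * m + B ≤ (2 : ℝ) ^ (τ * m) := by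
  have hlog : 0 < τ * Real.log 2 := mul_pos hτ (Real.log_pos (by norm_num))
  have h1 := (isLittleO_pow_exp_pos_mul_atTop 1 hlog).bound
    (by positivity : 0 < 1 / (2 * (|A| + 1)))
  have h1 := tendsto_natCast_atTop_atTop.eventually h1
  have h2 : ∀ᶠ m : ℕ in atTop, 2 * |B| ≤ m :=
    tendsto_natCast_atTop_atTop.eventually (eventually_ge_atTop (2 * |B|))
  filter_upwards [h1, h2] with m h1 h2
  have e : Real.exp (τ * Real.log 2 * m) = (2 : ℝ) ^ (τ * m) := by
    rw [Real.rpow_def_of_pos (by norm_num)]; ring_nf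
  rw [e, pow_one, Real.norm_of_nonneg (Nat.cast_nonneg m), Real.norm_of_nonneg (by positivity),
    div_mul_eq_mul_div, one_mul, le_div_iff₀ (by positivity)] at h1
  have : A * m ≤ |A| * m := mul_le_mul_of_nonneg_right (le_abs_self A) (Nat.cast_nonneg m)
  have := le_abs_self B
  have := abs_nonneg B
  have : 0 ≤ |A| * (m : ℝ) := by positivity
  linarith

lemma IsRealGMeasure.exists_class {c : ℝ} {ν : Measure ℝ} (h : IsRealGMeasure c ν) {q Q : ℝ}
    (hq : 0 < q) {m : ℕ} (hm : 1 ≤ m) (hQ : 1 ≤ Q)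
    (hsum : Q ≤ ∑ a ∈ Finset.range (2 ^ m), ν.real (dyadic m a) ^ q) :
    ∃ (i : ℕ) (W : Finset ℕ), (∀ a ∈ W, a < 2 ^ m) ∧
      (∀ a ∈ W, (2 : ℝ) ^ (-((2 / q) * m)) ≤ ν.real (dyadic m a)) ∧
      (∀ a ∈ W, (2 : ℝ) ^ (-((i : ℝ) + 1)) ≤ ν.real (dyadic m a)) ∧
      Q / (2 * (2 / q * m + 1)) * 2 ^ (i * q) ≤ W.card := by
  have := h.prob
  set P := fun a => ν.real (dyadic m a)
  set A := 2 / q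
  have hA : 0 < A := by positivity
  have hP0 : ∀ a, 0 ≤ P a := fun a => measureReal_nonneg
  have hP1 : ∀ a, P a ≤ 1 := fun a => measureReal_le_one
  set G := (Finset.range (2 ^ m)).filter fun a => (2 : ℝ) ^ (-(A * m)) ≤ P a
  have hbad : ∑ a ∈ (Finset.range (2 ^ m)).filter (fun a => ¬ (2 : ℝ) ^ (-(A * m)) ≤ P a),
      P a ^ q ≤ 1 / 2 := by
    calc _ ≤ ∑ a ∈ (Finset.range (2 ^ m)).filter (fun a => ¬ (2 : ℝ) ^ (-(A * m)) ≤ P a),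
          (2 : ℝ) ^ (-(2 * (m : ℝ))) := by
          refine Finset.sum_le_sum fun a ha => ?_
          have ha := (not_le.1 (Finset.mem_filter.1 ha).2).le
          calc P a ^ q ≤ ((2 : ℝ) ^ (-(A * m))) ^ q := Real.rpow_le_rpow (hP0 a) ha hq.le
            _ = _ := by
              rw [← Real.rpow_mul (by norm_num)]
              congr 1
              simp only [A]; field_simp
      _ ≤ ∑ a ∈ Finset.range (2 ^ m), (2 : ℝ) ^ (-(2 * (m : ℝ))) :=
          Finset.sum_le_sum_of_subset_of_nonneg (Finset.filter_subset _ _)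
            fun _ _ _ => by positivity
      _ = 2 ^ (-(m : ℝ)) := by
          rw [Finset.sum_const, Finset.card_range, nsmul_eq_mul]
          push_cast
          rw [← Real.rpow_natCast, ← Real.rpow_add (by norm_num)]
          ring_nf
      _ ≤ 2 ^ (-(1 : ℝ)) := by
          gcongr
          · norm_num
          · exact_mod_cast hm
      _ = 1 / 2 := by rw [Real.rpow_neg_one]; norm_num
  have hgood : Q / 2 ≤ ∑ a ∈ G, P a ^ q := by
    have := Finset.sum_filter_add_sum_filter_not (Finset.range (2 ^ m))
      (fun a => (2 : ℝ) ^ (-(A * m)) ≤ P a) (fun a => P a ^ q)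
    have h2 : Q ≤ ∑ a ∈ Finset.range (2 ^ m), P a ^ q := hsum
    linarith
  have hGpos : ∀ a ∈ G, 0 < P a := fun a ha =>
    lt_of_lt_of_le (by positivity) (Finset.mem_filter.1 ha).2
  set idx : ℕ → ℕ := fun a => ⌊-Real.logb 2 (P a)⌋₊
  have hidx : ∀ a ∈ G, idx a ∈ Finset.range (⌊A * m⌋₊ + 1) := by
    intro a ha
    rw [Finset.mem_range, Nat.lt_succ_iff]
    apply Nat.floor_le_floor
    have := (Real.le_logb_iff_rpow_le (by norm_num) (hGpos a ha)).2 (Finset.mem_filter.1 ha).2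
    linarith
  have hAm : (0 : ℝ) ≤ A * m := by positivity
  have hfl : ((⌊A * m⌋₊ + 1 : ℕ) : ℝ) ≤ A * m + 1 := by
    push_cast; linarith [Nat.floor_le hAm]
  obtain ⟨i, _, hi⟩ := Finset.exists_le_sum_fiber_of_maps_to_of_nsmul_le_sum (s := G)
    (w := fun a => P a ^ q) (b := Q / (2 * (A * m + 1))) hidx ⟨0, by simp⟩ (by
      refine le_trans ?_ hgood
      rw [Finset.card_range, nsmul_eq_mul]
      calc _ ≤ (A * m + 1) * (Q / (2 * (A * m + 1))) := by gcongr
        _ = Q / 2 := by field_simp)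
  refine ⟨i, G.filter fun a => idx a = i, ?_, ?_, ?_, ?_⟩
  · intro a ha
    exact Finset.mem_range.1 (Finset.mem_filter.1 (Finset.mem_filter.1 ha).1).1
  · intro a ha
    exact (Finset.mem_filter.1 (Finset.mem_filter.1 ha).1).2
  · intro a ha
    obtain ⟨haG, hai⟩ := Finset.mem_filter.1 ha
    rw [← Real.le_logb_iff_rpow_le (by norm_num) (hGpos a haG)]
    have := Nat.lt_floor_add_one (-Real.logb 2 (P a))
    rw [show ⌊-Real.logb 2 (P a)⌋₊ = i from hai] at this
    linarith
  · have hle : ∑ a ∈ G.filter (fun a => idx a = i), P a ^ q ≤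
        ∑ a ∈ G.filter (fun a => idx a = i), (2 : ℝ) ^ (-(i * q)) := by
      refine Finset.sum_le_sum fun a ha => ?_
      obtain ⟨haG, hai⟩ := Finset.mem_filter.1 ha
      have hl : 0 ≤ -Real.logb 2 (P a) := by
        have := Real.logb_nonpos (by norm_num : (1 : ℝ) < 2) (hP0 a) (hP1 a)
        linarith
      have := Nat.floor_le hl
      rw [show ⌊-Real.logb 2 (P a)⌋₊ = i from hai] at this
      have h3 : P a ≤ (2 : ℝ) ^ (-(i : ℝ)) := by
        rw [← Real.logb_le_iff_le_rpow (by norm_num) (hGpos a haG)]; linarith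
      calc P a ^ q ≤ ((2 : ℝ) ^ (-(i : ℝ))) ^ q := Real.rpow_le_rpow (hP0 a) h3 hq.le
        _ = _ := by rw [← Real.rpow_mul (by norm_num)]; ring_nf
    have := hi.trans hle
    rw [Finset.sum_const, nsmul_eq_mul, Real.rpow_neg (by norm_num), ← div_eq_mul_inv,
      le_div_iff₀ (by positivity)] at this
    exact this

/-- Frequent lower bounds on the moment sums produce a homogeneous family of words from which
free concatenation can start. -/
lemma IsRealGMeasure.exists_base {c : ℝ} {ν : Measure ℝ} (h : IsRealGMeasure c ν)
    (hc : c ∈ Ioo (0 : ℝ) 1) {r q' q : ℝ} (hr : 0 < r) (hq' : 0 < q') (hqq : q' < q)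
    (hfreq : ∀ η > 0, ∃ᶠ m : ℕ in atTop, (2 : ℝ) ^ (m * (r * q - η)) ≤
      ∑ a ∈ Finset.range (2 ^ m), ν.real (dyadic m a) ^ q) :
    ∃ (M C : ℕ) (s : ℝ), 2 ≤ C ∧ 0 < s ∧ s < 1 ∧ 1 ≤ C * s ^ q' ∧
      ∀ k, ∃ V : Finset ℕ, (∀ v ∈ V, v < 2 ^ (k * M)) ∧ C ^ k ≤ V.card ∧
        ∀ v ∈ V, s ^ k ≤ ν.real (dyadic (k * M) v) * 2 ^ (-(r * (k * M : ℕ))) := by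
  have hq : 0 < q := hq'.trans hqq
  have hd : 0 < r * (q - q') := mul_pos hr (by linarith)
  set ε := r * (q - q') / (4 * q' * (1 + r)) with hε
  have hε0 : 0 < ε := by positivity
  have hεe : q' * ε * (1 + r) = r * (q - q') / 4 := by rw [hε]; field_simp
  obtain ⟨m, hQ, ⟨L, hL, glue⟩, hm1, hbig⟩ :=
    ((hfreq (r * (q - q') / 4) (by positivity)).and_eventually
    ((h.eventually_glue hc hε0 (by positivity : 0 < 2 / q)).and
      ((eventually_ge_atTop 1).and (eventually_mul_add_le_rpow (A := 2 * 2 ^ q' * (2 / q))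
        (B := 2 * 2 ^ q') (by positivity : 0 < r * (q - q') / 2))))).exists
  have hQ1 : (1 : ℝ) ≤ 2 ^ (m * (r * q - r * (q - q') / 4)) := by
    apply Real.one_le_rpow (by norm_num)
    have : 0 ≤ r * q - r * (q - q') / 4 := by nlinarith [mul_pos hr hq', mul_pos hr hq]
    positivity
  obtain ⟨i, W, hW, hWA, hWi, hcard⟩ := h.exists_class hq hm1 hQ1 hQ
  set e := ε * m + (i + 1) with he
  set s₀ := (2 : ℝ) ^ (-e) with hs₀
  set s := (2 : ℝ) ^ (-(e + r * (m + L : ℕ))) with hs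
  have he1 : 1 ≤ e := by
    have : 0 ≤ ε * m := by positivity
    have : (0 : ℝ) ≤ i := Nat.cast_nonneg i
    linarith
  have hs1 : s < 1 := by
    apply Real.rpow_lt_one_of_one_lt_of_neg (by norm_num)
    have : 0 ≤ r * (m + L : ℕ) := by positivity
    linarith
  have hs0 : 0 < s := by positivity
  have hmain : 1 ≤ W.card * s ^ q' := by
    have h1 : (2 : ℝ) ^ (-(q' * (ε * m + (i + 1) + r * (m + ε * m)))) ≤ s ^ q' := by
      rw [hs, ← Real.rpow_mul (by norm_num)]
      apply Real.rpow_le_rpow_of_exponent_le (by norm_num)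
      push_cast
      have : r * (m + L) ≤ r * (m + ε * m) := by gcongr
      nlinarith
    have hm0 : (0 : ℝ) ≤ m := Nat.cast_nonneg m
    have hi0 : (0 : ℝ) ≤ i := Nat.cast_nonneg i
    have h2 : (2 : ℝ) ^ (r * (q - q') / 2 * m) * 2 ^ (-q') ≤
        2 ^ (m * (r * q - r * (q - q') / 4)) * 2 ^ (i * q) *
          2 ^ (-(q' * (ε * m + (i + 1) + r * (m + ε * m)))) := by
      rw [← Real.rpow_add (by norm_num), ← Real.rpow_add (by norm_num),
        ← Real.rpow_add (by norm_num)]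
      apply Real.rpow_le_rpow_of_exponent_le (by norm_num)
      have e1 : -(q' * (ε * m + (i + 1) + r * (m + ε * m))) =
          -(q' * ε * (1 + r)) * m - q' * i - q' - r * q' * m := by ring
      rw [e1, hεe]
      nlinarith [mul_le_mul_of_nonneg_right hqq.le hi0]
    have hD : 0 < 2 * (2 / q * (m : ℝ) + 1) := by positivity
    calc (1 : ℝ) ≤ 2 ^ (r * (q - q') / 2 * m) * 2 ^ (-q') / (2 * (2 / q * m + 1)) := by
          rw [le_div_iff₀ hD, one_mul, Real.rpow_neg (by norm_num), ← div_eq_mul_inv,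
            le_div_iff₀ (by positivity)]
          calc _ = 2 * 2 ^ q' * (2 / q) * m + 2 * 2 ^ q' := by ring
            _ ≤ _ := hbig
      _ ≤ 2 ^ (m * (r * q - r * (q - q') / 4)) * 2 ^ (i * q) *
          2 ^ (-(q' * (ε * m + (i + 1) + r * (m + ε * m)))) / (2 * (2 / q * m + 1)) := by gcongr
      _ = 2 ^ (m * (r * q - r * (q - q') / 4)) / (2 * (2 / q * m + 1)) * 2 ^ (i * q) *
          2 ^ (-(q' * (ε * m + (i + 1) + r * (m + ε * m)))) := by ring
      _ ≤ W.card * s ^ q' := by gcongr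
  refine ⟨m + L, W.card, s, ?_, hs0, hs1, hmain, fun k => ?_⟩
  · by_contra! hlt
    have : (W.card : ℝ) ≤ 1 := by exact_mod_cast Nat.lt_succ_iff.1 hlt
    have h3 := Real.rpow_lt_one hs0.le hs1 hq'
    have h4 : 0 < s ^ q' := by positivity
    nlinarith
  · obtain ⟨V, hV, hVc, hVP⟩ := h.exists_chain (s := s₀) (L := L) (by positivity) hW (by
      intro a ha N d hd hpos
      obtain ⟨b, hb, hle⟩ := glue a (hW a ha) (hWA a ha) N d hd hpos
      refine ⟨b, hb, le_trans ?_ hle⟩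
      gcongr
      rw [hs₀, he, neg_add, Real.rpow_add (by norm_num)]
      gcongr
      exact hWi a ha) k
    refine ⟨V, hV, hVc, fun v hv => ?_⟩
    have : s ^ k = s₀ ^ k * 2 ^ (-(r * (k * (m + L) : ℕ))) := by
      rw [hs, hs₀, ← Real.rpow_natCast, ← Real.rpow_natCast, ← Real.rpow_mul (by norm_num),
        ← Real.rpow_mul (by norm_num), ← Real.rpow_add (by norm_num)]
      congr 1; push_cast; ring
    rw [this]
    gcongr
    exact hVP v hv

lemma exists_far_indices {α : Finset ℝ} {V : Finset ℕ} {n : ℕ} (l : ℕ) (hα : α.Nonempty)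
    (hn : α.card ≤ n) (hV : 4 * n ≤ V.card) :
    ∃ V' ⊆ V, n ≤ V'.card ∧
      ∀ v ∈ V', ∀ x ∈ dyadic l v, (2 : ℝ) ^ (-(l : ℝ)) ≤ Metric.infDist x (α : Set ℝ) := by
  classical
  set near : ℝ → Finset ℕ := fun y =>
    {(⌊2 ^ l * y⌋ - 1).toNat, ⌊2 ^ l * y⌋.toNat, (⌊2 ^ l * y⌋ + 1).toNat}
  refine ⟨V \ α.biUnion near, Finset.sdiff_subset, ?_, ?_⟩
  · have h1 : (α.biUnion near).card ≤ α.card * 3 :=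
      Finset.card_biUnion_le_card_mul _ _ _ fun y _ => Finset.card_le_three
    have h2 := Finset.le_card_sdiff (α.biUnion near) V
    omega
  · intro v hv x hx
    have h2 : (0 : ℝ) < 2 ^ l := by positivity
    rw [Real.rpow_neg (by norm_num), Real.rpow_natCast]
    refine (Metric.le_infDist (by simpa using hα)).2 fun {y} hy => ?_
    by_contra! hlt
    refine (Finset.mem_sdiff.1 hv).2 (Finset.mem_biUnion.2 ⟨y, hy, ?_⟩)
    rw [Real.dist_eq, ← one_div, lt_div_iff₀ h2, ← abs_of_pos h2, ← abs_mul,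
      abs_lt] at hlt
    have hx := mem_dyadic_iff.1 hx
    have h3 := Int.floor_le (2 ^ l * y)
    have h4 := Int.lt_floor_add_one (2 ^ l * y)
    have h5 : (v : ℝ) < ⌊2 ^ l * y⌋ + 2 := by linarith
    have h6 : (⌊2 ^ l * y⌋ : ℝ) < v + 2 := by linarith
    have h5 : (v : ℤ) < ⌊2 ^ l * y⌋ + 2 := by exact_mod_cast h5
    have h6 : ⌊2 ^ l * y⌋ < (v : ℤ) + 2 := by exact_mod_cast h6
    simp only [near, Finset.mem_insert, Finset.mem_singleton]
    omega

lemma measurable_infDist_rpow (α : Set ℝ) (r : ℝ) :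
    Measurable fun x => Metric.infDist x α ^ r :=
  (Metric.continuous_infDist_pt α).measurable.pow_const r

lemma integrable_infDist_rpow {ν : Measure ℝ} [IsProbabilityMeasure ν]
    (hν : ∀ᵐ x ∂ν, x ∈ Ico (0 : ℝ) 1) {α : Finset ℝ} (hα : α.Nonempty) {r : ℝ} (hr : 0 < r) :
    Integrable (fun x => Metric.infDist x (α : Set ℝ) ^ r) ν := by
  obtain ⟨y, hy⟩ := hα
  refine Integrable.of_bound (measurable_infDist_rpow _ r).aestronglyMeasurable
    ((1 + |y|) ^ r) ?_
  filter_upwards [hν] with x hx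
  rw [Real.norm_of_nonneg (Real.rpow_nonneg Metric.infDist_nonneg r)]
  refine Real.rpow_le_rpow Metric.infDist_nonneg ?_ hr.le
  refine (Metric.infDist_le_dist_of_mem (Finset.mem_coe.2 hy)).trans ?_
  rw [Real.dist_eq]
  refine (abs_sub x y).trans ?_
  rw [abs_of_nonneg hx.1]
  linarith [hx.2]

lemma le_integral_infDist {ν : Measure ℝ} [IsProbabilityMeasure ν]
    (hν : ∀ᵐ x ∂ν, x ∈ Ico (0 : ℝ) 1) {r : ℝ} (hr : 0 < r) {l n : ℕ} {V : Finset ℕ} {t : ℝ}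
    (ht : 0 ≤ t) (hV : 4 * n ≤ V.card)
    (hP : ∀ v ∈ V, t ≤ ν.real (dyadic l v) * 2 ^ (-(r * l)))
    {α : Finset ℝ} (hα : α.Nonempty) (hn : α.card ≤ n) :
    n * t ≤ ∫ x, Metric.infDist x (α : Set ℝ) ^ r ∂ν := by
  obtain ⟨V', hV', hcard, hfar⟩ := exists_far_indices l hα hn hV
  have hinteg := integrable_infDist_rpow hν hα hr
  have hnn : ∀ x, 0 ≤ Metric.infDist x (α : Set ℝ) ^ r := fun x =>
    Real.rpow_nonneg Metric.infDist_nonneg r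
  have hU : MeasurableSet (⋃ v ∈ V', dyadic l v) :=
    Finset.measurableSet_biUnion _ fun v _ => measurableSet_dyadic l v
  calc (n : ℝ) * t ≤ V'.card * t := by gcongr
    _ = ∑ v ∈ V', t := by simp
    _ ≤ ∑ v ∈ V', ν.real (dyadic l v) * 2 ^ (-(r * l)) :=
        Finset.sum_le_sum fun v hv => hP v (hV' hv)
    _ = ν.real (⋃ v ∈ V', dyadic l v) * 2 ^ (-(r * l)) := by
        rw [← Finset.sum_mul, measureReal_biUnion_finset
          (pairwise_disjoint_dyadic l _) fun v _ => measurableSet_dyadic l v]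
    _ = ∫ _ in ⋃ v ∈ V', dyadic l v, (2 : ℝ) ^ (-(r * l)) ∂ν := by simp
    _ ≤ ∫ x in ⋃ v ∈ V', dyadic l v, Metric.infDist x (α : Set ℝ) ^ r ∂ν := by
        refine setIntegral_mono_on (integrable_const _).integrableOn hinteg.integrableOn hU ?_
        intro x hx
        obtain ⟨v, hv, hxv⟩ := mem_iUnion₂.1 hx
        calc (2 : ℝ) ^ (-(r * l)) = (2 ^ (-(l : ℝ))) ^ r := by
              rw [← Real.rpow_mul (by norm_num)]; ring_nf
          _ ≤ _ := Real.rpow_le_rpow (by positivity) (hfar v hv x hxv) hr.le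
    _ ≤ ∫ x, Metric.infDist x (α : Set ℝ) ^ r ∂ν :=
        setIntegral_le_integral hinteg (Eventually.of_forall hnn)

lemma quantErr_nonneg (ν : Measure ℝ) (r : ℝ) (n : ℕ) : 0 ≤ quantErr ν r n := by
  apply Real.sInf_nonneg
  rintro _ ⟨α, -, -, rfl⟩
  exact Real.rpow_nonneg
    (integral_nonneg fun x => Real.rpow_nonneg Metric.infDist_nonneg r) _

lemma quantErr_le (ν : Measure ℝ) {r b : ℝ} {n : ℕ} (hr : 0 < r) {α : Finset ℝ} (hα : α.Nonempty)
    (hn : α.card ≤ n) (hb : ∫ x, Metric.infDist x (α : Set ℝ) ^ r ∂ν ≤ b) :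
    quantErr ν r n ≤ b ^ (1 / r) := by
  have hnn : ∀ α : Finset ℝ, 0 ≤ ∫ x, Metric.infDist x (α : Set ℝ) ^ r ∂ν := fun α =>
    integral_nonneg fun x => Real.rpow_nonneg Metric.infDist_nonneg r
  refine le_trans ?_ (Real.rpow_le_rpow (hnn α) hb (by positivity))
  rw [quantErr]
  refine csInf_le ⟨0, ?_⟩ ⟨α, hα, hn, rfl⟩
  rintro _ ⟨α', -, -, rfl⟩
  exact Real.rpow_nonneg (hnn α') _

lemma IsRealGMeasure.exists_le_quantErr {c : ℝ} {ν : Measure ℝ} (h : IsRealGMeasure c ν)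
    (hc : c ∈ Ioo (0 : ℝ) 1) {r q' q : ℝ} (hr : 0 < r) (hq' : 0 < q') (hqq : q' < q)
    (hfreq : ∀ η > 0, ∃ᶠ m : ℕ in atTop, (2 : ℝ) ^ (m * (r * q - η)) ≤
      ∑ a ∈ Finset.range (2 ^ m), ν.real (dyadic m a) ^ q) :
    ∃ b > 0, ∀ n : ℕ, 1 ≤ n → b * (n : ℝ) ^ (-((1 - q') / (r * q'))) ≤ quantErr ν r n := by
  have := h.prob
  obtain ⟨M, C, s, hC, hs0, hs1, hCs, hchain⟩ := h.exists_base hc hr hq' hqq hfreq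
  have hC0 : (0 : ℝ) < C := by positivity
  refine ⟨((4 * C : ℝ) ^ (-(1 / q'))) ^ (1 / r), by positivity, fun n hn => ?_⟩
  have hn0 : (0 : ℝ) < n := by exact_mod_cast hn
  set k := Nat.clog C (4 * n)
  have hk1 : 4 * n ≤ C ^ k := Nat.le_pow_clog hC _
  have hk2 : C ^ k ≤ C * (4 * n) := by
    have h1 : C ^ (k - 1) < 4 * n := Nat.pow_pred_clog_lt_self hC (by omega)
    have h2 : 0 < k := Nat.clog_pos hC (by omega)
    obtain ⟨j, hj⟩ := Nat.exists_eq_succ_of_ne_zero h2.ne'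
    rw [hj, Nat.succ_eq_add_one, pow_succ, mul_comm]
    rw [hj] at h1
    exact Nat.mul_le_mul_left _ h1.le
  have hsk : (C * (4 * n) : ℝ) ^ (-(1 / q')) ≤ s ^ k := by
    have h1 : (C : ℝ) ^ (-(1 / q')) ≤ s := by
      have : (C : ℝ)⁻¹ ≤ s ^ q' := by
        rwa [inv_le_iff_one_le_mul₀' hC0]
      calc (C : ℝ) ^ (-(1 / q')) = ((C : ℝ)⁻¹) ^ (1 / q') := by
            rw [Real.rpow_neg hC0.le, Real.inv_rpow hC0.le]
        _ ≤ (s ^ q') ^ (1 / q') := Real.rpow_le_rpow (by positivity) this (by positivity)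
        _ = s := by rw [← Real.rpow_mul hs0.le, mul_one_div_cancel hq'.ne', Real.rpow_one]
    calc (C * (4 * n) : ℝ) ^ (-(1 / q')) ≤ ((C : ℝ) ^ k) ^ (-(1 / q')) :=
          Real.rpow_le_rpow_of_nonpos (by positivity) (by exact_mod_cast hk2)
            (by simp; positivity)
      _ = ((C : ℝ) ^ (-(1 / q'))) ^ k := by
          rw [← Real.rpow_natCast, ← Real.rpow_natCast, ← Real.rpow_mul hC0.le,
            ← Real.rpow_mul hC0.le, mul_comm]
      _ ≤ s ^ k := by gcongr
  obtain ⟨V, -, hVc, hVP⟩ := hchain k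
  refine le_csInf ⟨_, {0}, by simp, by simpa using hn, rfl⟩ ?_
  rintro _ ⟨α, hα, hαn, rfl⟩
  have key := le_integral_infDist h.ae_mem hr (pow_pos hs0 k).le (hk1.trans hVc) hVP hα hαn
  refine le_trans ?_ (Real.rpow_le_rpow (by positivity)
    ((mul_le_mul_of_nonneg_left hsk hn0.le).trans key) (by positivity))
  apply le_of_eq
  have hK : (0 : ℝ) < 4 * C := by positivity
  rw [show (C * (4 * n) : ℝ) = 4 * C * n by ring]
  generalize (4 * C : ℝ) = K at hK
  have hexp : (1 + -(1 / q')) * (1 / r) = -((1 - q') / (r * q')) := by field_simp; ring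
  calc (K ^ (-(1 / q'))) ^ (1 / r) * (n : ℝ) ^ (-((1 - q') / (r * q')))
      = (K ^ (-(1 / q'))) ^ (1 / r) * ((n : ℝ) ^ (1 + -(1 / q'))) ^ (1 / r) := by
        rw [← Real.rpow_mul hn0.le, hexp]
    _ = (K ^ (-(1 / q')) * (n : ℝ) ^ (1 + -(1 / q'))) ^ (1 / r) :=
        (Real.mul_rpow (by positivity) (by positivity)).symm
    _ = (n * (K * n) ^ (-(1 / q'))) ^ (1 / r) := by
        rw [Real.mul_rpow hK.le hn0.le, Real.rpow_add hn0, Real.rpow_one]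
        ring_nf

lemma infDist_rpow_le_sum_leaves {r t : ℝ} (hr : 0 < r) (B C : Finset (Σ _ : ℕ, ℕ))
    (J : ℕ → ℕ → ℝ) (h00 : t ≤ J 0 0)
    (hB : ∀ n k, k < 2 ^ n → t ≤ J n k → (⟨n, k⟩ : Σ _ : ℕ, ℕ) ∈ B)
    (hJ : ∃ n₀, ∀ n k, n₀ ≤ n → J n k < t)
    (hC : ∀ p ∈ B, ∀ b < 2, (⟨p.1 + 1, 2 * p.2 + b⟩ : Σ _ : ℕ, ℕ) ∈ C) {x : ℝ}
    (hx : x ∈ Ico (0 : ℝ) 1) :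
    Metric.infDist x ((C.image fun p : Σ _ : ℕ, ℕ => (p.2 : ℝ) / 2 ^ p.1 : Finset ℝ) : Set ℝ) ^ r ≤
      ∑ p ∈ C with J p.1 p.2 < t,
        (dyadic p.1 p.2).indicator (fun _ => (2 : ℝ) ^ (-(r * p.1))) x := by
  classical
  have hex : ∃ n, J n ⌊2 ^ n * x⌋₊ < t := by
    obtain ⟨n₀, hn₀⟩ := hJ
    exact ⟨n₀, hn₀ _ _ le_rfl⟩
  have hfind := Nat.find_spec hex
  have hmin := fun m hm => not_lt.1 (Nat.find_min hex (m := m) hm)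
  generalize Nat.find hex = n at hfind hmin
  obtain ⟨j, rfl⟩ : ∃ j, n = j + 1 := by
    refine Nat.exists_eq_succ_of_ne_zero ?_
    rintro rfl
    have : ⌊x⌋₊ = 0 := Nat.floor_eq_zero.2 hx.2
    simp only [pow_zero, one_mul, this] at hfind
    linarith
  obtain ⟨hk, hxk⟩ := dyadic_floor_mem hx j
  obtain ⟨-, hxl⟩ := dyadic_floor_mem hx (j + 1)
  have hmem : (⟨j + 1, ⌊2 ^ (j + 1) * x⌋₊⟩ : Σ _ : ℕ, ℕ) ∈ C := by
    have h1 := mem_dyadic_iff.1 hxk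
    have h2 := mem_dyadic_iff.1 hxl
    have e : (2 : ℝ) ^ (j + 1) * x = 2 * (2 ^ j * x) := by ring
    rw [e] at h2 ⊢
    have h3 : (2 * ⌊2 ^ j * x⌋₊ : ℝ) < ⌊2 * (2 ^ j * x)⌋₊ + 1 := by linarith
    have h4 : (⌊2 * (2 ^ j * x)⌋₊ : ℝ) < 2 * ⌊2 ^ j * x⌋₊ + 2 := by linarith
    have h3 : 2 * ⌊2 ^ j * x⌋₊ < ⌊2 * (2 ^ j * x)⌋₊ + 1 := by exact_mod_cast h3
    have h4 : ⌊2 * (2 ^ j * x)⌋₊ < 2 * ⌊2 ^ j * x⌋₊ + 2 := by exact_mod_cast h4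
    have := hC _ (hB j _ hk (hmin j (Nat.lt_succ_self j)))
      (⌊2 * (2 ^ j * x)⌋₊ - 2 * ⌊2 ^ j * x⌋₊) (by omega)
    rwa [show 2 * ⌊2 ^ j * x⌋₊ + (⌊2 * (2 ^ j * x)⌋₊ - 2 * ⌊2 ^ j * x⌋₊) =
      ⌊2 * (2 ^ j * x)⌋₊ by omega] at this
  have hle : Metric.infDist x ((C.image fun p : Σ _ : ℕ, ℕ => (p.2 : ℝ) / 2 ^ p.1 : Finset ℝ) :
      Set ℝ) ≤ 2 ^ (-((j + 1 : ℕ) : ℝ)) := by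
    refine (Metric.infDist_le_dist_of_mem
      (Finset.mem_coe.2 (Finset.mem_image_of_mem _ hmem))).trans ?_
    rw [Real.dist_eq, abs_of_nonneg (sub_nonneg.2 hxl.1), Real.rpow_neg (by norm_num),
      Real.rpow_natCast]
    have := hxl.2
    rw [add_div, one_div] at this
    linarith
  calc _ ≤ ((2 : ℝ) ^ (-((j + 1 : ℕ) : ℝ))) ^ r :=
        Real.rpow_le_rpow Metric.infDist_nonneg hle hr.le
    _ = (2 : ℝ) ^ (-(r * (j + 1 : ℕ))) := by rw [← Real.rpow_mul (by norm_num)]; ring_nf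
    _ = (dyadic (j + 1) ⌊2 ^ (j + 1) * x⌋₊).indicator
          (fun _ => (2 : ℝ) ^ (-(r * (j + 1 : ℕ)))) x := by rw [indicator_of_mem hxl]
    _ ≤ _ := by
        refine Finset.single_le_sum (f := fun p : Σ _ : ℕ, ℕ =>
          (dyadic p.1 p.2).indicator (fun _ => (2 : ℝ) ^ (-(r * p.1))) x)
          (fun p _ => indicator_nonneg (fun _ _ => by positivity) _)
          (Finset.mem_filter.2 ⟨hmem, hfind⟩)

/-- Stopping the dyadic tree at the level where `ν(I) |I| ^ r` drops below `t` yields a good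
quantizing set. -/
lemma exists_quantizer {ν : Measure ℝ} [IsProbabilityMeasure ν]
    (hν : ∀ᵐ x ∂ν, x ∈ Ico (0 : ℝ) 1) {r q S t : ℝ} (hr : 0 < r) (hq : 0 < q)
    (ht0 : 0 < t) (ht1 : t ≤ 1)
    (hS : ∀ N, ∑ n ∈ Finset.range N, ∑ k ∈ Finset.range (2 ^ n),
      (ν.real (dyadic n k) * 2 ^ (-(r * n))) ^ q ≤ S) :
    ∃ α : Finset ℝ, α.Nonempty ∧ (α.card : ℝ) ≤ 2 * S * t ^ (-q) ∧
      ∫ x, Metric.infDist x (α : Set ℝ) ^ r ∂ν ≤ 2 * S * t ^ (1 - q) := by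
  classical
  set J : ℕ → ℕ → ℝ := fun n k => ν.real (dyadic n k) * 2 ^ (-(r * n)) with hJdef
  have hJ0 : ∀ n k, 0 ≤ J n k := fun n k => by positivity
  have hν1 : ν.real (Ico 0 1) = 1 := by
    rw [measureReal_def, prob_compl_eq_zero_iff measurableSet_Ico |>.1 hν]
    simp
  have hJle : ∀ n k, J n k ≤ 2 ^ (-(r * n)) := fun n k =>
    mul_le_of_le_one_left (by positivity) measureReal_le_one
  obtain ⟨n₀, hn₀⟩ : ∃ n₀, ∀ n k, n₀ ≤ n → J n k < t := by
    have hlt : (2 : ℝ) ^ (-r) < 1 := Real.rpow_lt_one_of_one_lt_of_neg (by norm_num) (by linarith)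
    obtain ⟨n₀, h₀⟩ := exists_pow_lt_of_lt_one ht0 hlt
    refine ⟨n₀, fun n k hn => (hJle n k).trans_lt (lt_of_le_of_lt ?_ h₀)⟩
    rw [← Real.rpow_natCast, ← Real.rpow_mul (by norm_num)]
    apply Real.rpow_le_rpow_of_exponent_le (by norm_num)
    have : (n₀ : ℝ) ≤ n := by exact_mod_cast hn
    nlinarith
  set B : Finset (Σ _ : ℕ, ℕ) :=
    ((Finset.range n₀).sigma fun n => Finset.range (2 ^ n)).filter fun p => t ≤ J p.1 p.2 with hBdef
  have hB : ∀ n k, k < 2 ^ n → t ≤ J n k → (⟨n, k⟩ : Σ _ : ℕ, ℕ) ∈ B := by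
    intro n k hk ht
    simp only [hBdef, Finset.mem_filter, Finset.mem_sigma, Finset.mem_range]
    exact ⟨⟨not_le.1 fun hn => not_lt.2 ht (hn₀ n k hn), hk⟩, ht⟩
  have h00 : t ≤ J 0 0 := by simpa [hJdef, dyadic_zero, hν1] using ht1
  have hcardB : (B.card : ℝ) ≤ S * t ^ (-q) := by
    rw [Real.rpow_neg ht0.le, ← div_eq_mul_inv, le_div_iff₀ (by positivity)]
    calc (B.card : ℝ) * t ^ q = ∑ p ∈ B, t ^ q := by simp
      _ ≤ ∑ p ∈ B, J p.1 p.2 ^ q := Finset.sum_le_sum fun p hp =>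
          Real.rpow_le_rpow ht0.le (Finset.mem_filter.1 hp).2 hq.le
      _ ≤ ∑ p ∈ (Finset.range n₀).sigma fun n => Finset.range (2 ^ n), J p.1 p.2 ^ q :=
          Finset.sum_le_sum_of_subset_of_nonneg (Finset.filter_subset _ _)
            fun p _ _ => Real.rpow_nonneg (hJ0 _ _) q
      _ ≤ S := by rw [Finset.sum_sigma]; exact hS n₀
  set C : Finset (Σ _ : ℕ, ℕ) :=
    (B ×ˢ Finset.range 2).image fun pb => ⟨pb.1.1 + 1, 2 * pb.1.2 + pb.2⟩ with hCdef
  have hC : ∀ p ∈ B, ∀ b < 2, (⟨p.1 + 1, 2 * p.2 + b⟩ : Σ _ : ℕ, ℕ) ∈ C := fun p hp b hb =>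
    Finset.mem_image.2 ⟨(p, b), Finset.mem_product.2 ⟨hp, Finset.mem_range.2 hb⟩, rfl⟩
  have hcardC : (C.card : ℝ) ≤ 2 * S * t ^ (-q) := by
    have h1 : C.card ≤ B.card * 2 := by
      refine Finset.card_image_le.trans ?_
      rw [Finset.card_product, Finset.card_range]
    have h2 : (C.card : ℝ) ≤ B.card * 2 := by exact_mod_cast h1
    linarith
  refine ⟨C.image fun p => (p.2 : ℝ) / 2 ^ p.1, ?_, ?_, ?_⟩
  · exact ⟨_, Finset.mem_image_of_mem _ (hC _ (hB 0 0 (by norm_num) h00) 0 (by norm_num))⟩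
  · exact le_trans (by exact_mod_cast Finset.card_image_le) hcardC
  · have hinteg : ∀ p : Σ _ : ℕ, ℕ, Integrable
        ((dyadic p.1 p.2).indicator fun _ => (2 : ℝ) ^ (-(r * p.1))) ν := fun p =>
      (integrable_const _).indicator (measurableSet_dyadic _ _)
    calc _ ≤ ∫ x, ∑ p ∈ C with J p.1 p.2 < t,
            (dyadic p.1 p.2).indicator (fun _ => (2 : ℝ) ^ (-(r * p.1))) x ∂ν := by
          refine integral_mono_of_nonneg (Eventually.of_forall fun x =>
            Real.rpow_nonneg Metric.infDist_nonneg r)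
            (integrable_finsetSum _ fun p _ => hinteg p) ?_
          filter_upwards [hν] with x hx
          exact infDist_rpow_le_sum_leaves hr B C J h00 hB ⟨n₀, hn₀⟩ hC hx
      _ = ∑ p ∈ C with J p.1 p.2 < t, J p.1 p.2 := by
          rw [integral_finsetSum _ fun p _ => hinteg p]
          refine Finset.sum_congr rfl fun p _ => ?_
          rw [integral_indicator_const _ (measurableSet_dyadic _ _), smul_eq_mul]
      _ ≤ ∑ p ∈ C with J p.1 p.2 < t, t :=
          Finset.sum_le_sum fun p hp => (Finset.mem_filter.1 hp).2.le
      _ ≤ C.card * t := by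
          rw [Finset.sum_const, nsmul_eq_mul]
          gcongr
          exact Finset.filter_subset _ _
      _ ≤ 2 * S * t ^ (-q) * t := by gcongr
      _ = 2 * S * t ^ (1 - q) := by
          rw [sub_eq_neg_add, Real.rpow_add ht0, Real.rpow_one, mul_assoc]

lemma exists_quantErr_le {ν : Measure ℝ} [IsProbabilityMeasure ν]
    (hν : ∀ᵐ x ∂ν, x ∈ Ico (0 : ℝ) 1) {r q S : ℝ} (hr : 0 < r) (hq : 0 < q)
    (hS : ∀ N, ∑ n ∈ Finset.range N, ∑ k ∈ Finset.range (2 ^ n),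
      (ν.real (dyadic n k) * 2 ^ (-(r * n))) ^ q ≤ S) :
    ∃ b > 0, ∀ᶠ n : ℕ in atTop, quantErr ν r n ≤ b * (n : ℝ) ^ (-((1 - q) / (r * q))) := by
  have hS0 : 0 < S := by
    have hν1 : ν.real (Ico 0 1) = 1 := by
      rw [measureReal_def, prob_compl_eq_zero_iff measurableSet_Ico |>.1 hν]
      simp
    have := hS 1
    simp [dyadic_zero, hν1] at this
    linarith
  refine ⟨((2 * S) ^ (1 / q)) ^ (1 / r), by positivity, ?_⟩
  filter_upwards [eventually_ge_atTop 1,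
    tendsto_natCast_atTop_atTop.eventually (eventually_ge_atTop (2 * S))] with n hn1 hnS
  have hn0 : (0 : ℝ) < n := by exact_mod_cast hn1
  have hK : 0 < 2 * S := by positivity
  obtain ⟨α, hα, hcard, hinteg⟩ := exists_quantizer hν hr hq (t := (2 * S / n) ^ (1 / q))
    (by positivity) (Real.rpow_le_one (by positivity) ((div_le_one hn0).2 hnS) (by positivity)) hS
  generalize 2 * S = K at *
  have hKn : 0 ≤ K / n := by positivity
  have hcard' : α.card ≤ n := by
    have e : K * ((K / n) ^ (1 / q)) ^ (-q) = n := by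
      rw [← Real.rpow_mul hKn, show 1 / q * -q = -1 by field_simp, Real.rpow_neg_one]
      field_simp
    rw [e] at hcard
    exact_mod_cast hcard
  refine (quantErr_le ν hr hα hcard' hinteg).trans (le_of_eq ?_)
  have e : K * ((K / n) ^ (1 / q)) ^ (1 - q) = K ^ (1 / q) * (n : ℝ) ^ (1 - 1 / q) := by
    rw [← Real.rpow_mul hKn, show 1 / q * (1 - q) = 1 / q - 1 by field_simp,
      Real.rpow_sub_one (by positivity), Real.div_rpow hK.le hn0.le, Real.rpow_sub hn0,
      Real.rpow_one]
    field_simp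
  rw [e, Real.mul_rpow (by positivity) (by positivity), ← Real.rpow_mul hn0.le]
  congr 2
  field_simp
  ring

lemma wordVal_cons (n : ℕ) (b : Bool) (ω : Fin n → Bool) :
    wordVal (n + 1) (Fin.cons b ω) = ((if b then 1 else 0) + wordVal n ω) / 2 := by
  rw [wordVal, Fin.sum_univ_succ, wordVal, add_div, Finset.sum_div]
  congr 1
  · simp
  · refine Finset.sum_congr rfl fun i _ => ?_
    simp only [Fin.cons_succ, Fin.val_succ]
    rw [pow_succ _ ((i : ℕ) + 1), div_div]

lemma sum_wordVal (n : ℕ) (F : ℝ → ℝ) :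
    ∑ ω : Fin n → Bool, F (wordVal n ω) = ∑ k ∈ Finset.range (2 ^ n), F (k / 2 ^ n) := by
  induction n generalizing F with
  | zero => simp [wordVal]
  | succ n ih =>
    have hcons : ∑ ω : Fin (n + 1) → Bool, F (wordVal (n + 1) ω) =
        ∑ b : Bool, ∑ ω : Fin n → Bool, F (wordVal (n + 1) (Fin.cons b ω)) := by
      rw [← (Fin.consEquiv fun _ : Fin (n + 1) => Bool).sum_comp, Fintype.sum_prod_type]
      rfl
    rw [hcons, Fintype.sum_bool]
    simp only [wordVal_cons, if_true, Bool.false_eq_true, if_false, zero_add]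
    rw [ih fun y => F ((1 + y) / 2), ih fun y => F (y / 2), pow_succ, mul_two,
      Finset.sum_range_add, add_comm]
    have h2 : (2 : ℝ) ^ n ≠ 0 := by positivity
    congr 1
    · refine Finset.sum_congr rfl fun k _ => ?_
      congr 1; field_simp; ring
    · refine Finset.sum_congr rfl fun k _ => ?_
      congr 1; push_cast; field_simp; ring

lemma sum_range_mod_succ {N : ℕ} (f : ℕ → ℝ) :
    ∑ k ∈ Finset.range N, f ((k + 1) % N) = ∑ k ∈ Finset.range N, f k := by
  cases N with
  | zero => simp
  | succ M =>
    rw [Finset.sum_range_succ, Finset.sum_range_succ', Nat.mod_self]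
    congr 1
    refine Finset.sum_congr rfl fun k hk => ?_
    rw [Nat.mod_eq_of_lt (by have := Finset.mem_range.1 hk; omega)]

/-- The mass of a closed dyadic arc of the circle. -/
def arcMass (μ : Measure Torus) (n k : ℕ) : ℝ :=
  μ.real ((fun x : ℝ => (x : Torus)) '' Icc ((k : ℝ) / 2 ^ n) (k / 2 ^ n + 1 / 2 ^ n))

lemma lqSum_eq (μ : Measure Torus) (q : ℝ) (n : ℕ) :
    lqSum μ q n = ∑ k ∈ Finset.range (2 ^ n), arcMass μ n k ^ q :=
  sum_wordVal n fun y => (μ.real ((fun x : ℝ => (x : Torus)) '' Icc y (y + 1 / 2 ^ n))) ^ q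

lemma measureReal_map_dyadic (μ : Measure Torus) (n k : ℕ) :
    (μ.map circleToReal).real (dyadic n k) = μ.real (circleToReal ⁻¹' dyadic n k) :=
  map_measureReal_apply measurable_circleToReal (measurableSet_dyadic n k)

lemma measureReal_dyadic_le_arcMass (μ : Measure Torus) [IsProbabilityMeasure μ] (n k : ℕ) :
    (μ.map circleToReal).real (dyadic n k) ≤ arcMass μ n k := by
  rw [measureReal_map_dyadic]
  refine measureReal_mono fun x hx => ⟨circleToReal x, ?_, coe_circleToReal x⟩
  rw [← add_div]
  exact ⟨hx.1, hx.2.le⟩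

lemma arcMass_le (μ : Measure Torus) [IsProbabilityMeasure μ] {n k : ℕ} (hk : k < 2 ^ n) :
    arcMass μ n k ≤ (μ.map circleToReal).real (dyadic n k) +
      (μ.map circleToReal).real (dyadic n ((k + 1) % 2 ^ n)) := by
  rw [measureReal_map_dyadic, measureReal_map_dyadic]
  refine le_trans (measureReal_mono ?_) (measureReal_union_le _ _)
  rintro _ ⟨t, ⟨ht1, ht2⟩, rfl⟩
  rw [← add_div] at ht2
  have h2 : (0 : ℝ) < 2 ^ n := by positivity
  have hk' : (k : ℝ) + 1 ≤ 2 ^ n := by exact_mod_cast hk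
  have ht0 : 0 ≤ t := le_trans (by positivity) ht1
  rcases ht2.lt_or_eq with hlt | rfl
  · left
    have hmem : t ∈ dyadic n k := ⟨ht1, hlt⟩
    rw [mem_preimage, circleToReal_coe (dyadic_subset hk hmem)]
    exact hmem
  · right
    rw [mem_preimage]
    rcases Nat.lt_or_ge (k + 1) (2 ^ n) with hlt | hge
    · have hmem : ((k : ℝ) + 1) / 2 ^ n ∈ dyadic n (k + 1) := by
        rw [mem_dyadic_iff]; push_cast
        rw [mul_div_cancel₀ _ h2.ne']
        constructor <;> linarith
      rw [Nat.mod_eq_of_lt hlt, circleToReal_coe (dyadic_subset hlt hmem)]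
      exact hmem
    · have e : k + 1 = 2 ^ n := le_antisymm hk hge
      have e' : (k : ℝ) + 1 = 2 ^ n := by exact_mod_cast e
      rw [e, Nat.mod_self, e', div_self h2.ne']
      have : ((1 : ℝ) : Torus) = ((0 : ℝ) : Torus) := by
        rw [AddCircle.coe_period, AddCircle.coe_zero]
      simp only [this]
      rw [circleToReal_coe ⟨le_rfl, one_pos⟩]
      exact ⟨by simp, by positivity⟩

lemma sum_dyadic_le_lqSum (μ : Measure Torus) [IsProbabilityMeasure μ] {q : ℝ} (hq : 0 ≤ q)
    (n : ℕ) : ∑ k ∈ Finset.range (2 ^ n), (μ.map circleToReal).real (dyadic n k) ^ q ≤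
      lqSum μ q n := by
  rw [lqSum_eq]
  exact Finset.sum_le_sum fun k _ =>
    Real.rpow_le_rpow measureReal_nonneg (measureReal_dyadic_le_arcMass μ n k) hq

lemma lqSum_le (μ : Measure Torus) [IsProbabilityMeasure μ] {q : ℝ} (hq : 0 < q) (hq1 : q ≤ 1)
    (n : ℕ) : lqSum μ q n ≤
      2 * ∑ k ∈ Finset.range (2 ^ n), (μ.map circleToReal).real (dyadic n k) ^ q := by
  rw [lqSum_eq, two_mul]
  nth_rw 3 [← sum_range_mod_succ]
  rw [← Finset.sum_add_distrib]
  refine Finset.sum_le_sum fun k hk => ?_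
  exact (Real.rpow_le_rpow measureReal_nonneg (arcMass_le μ (Finset.mem_range.1 hk)) hq.le).trans
    (Real.rpow_add_le_add_rpow measureReal_nonneg measureReal_nonneg hq.le hq1)

lemma one_le_lqSum {c : Torus} {μ : Measure Torus} (hμ : IsGMeasure c μ) {q : ℝ} (hq : 0 < q)
    (hq1 : q ≤ 1) (n : ℕ) : 1 ≤ lqSum μ q n := by
  have := hμ.1
  have := hμ.isRealGMeasure.prob
  refine le_trans ?_ (sum_dyadic_le_lqSum μ hq.le n)
  refine (hμ.isRealGMeasure.sum_measureReal_dyadic n).symm.le.trans ?_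
  refine Finset.sum_le_sum fun k _ => ?_
  exact Real.self_le_rpow_of_le_one measureReal_nonneg measureReal_le_one hq1

lemma lqUpper_lt_of_lqSum_le {c : Torus} {μ : Measure Torus} (hμ : IsGMeasure c μ) {q : ℝ}
    (hq : 0 < q) (hq1 : q ≤ 1) {K β γ : ℝ} (hβγ : β < γ)
    (hK : ∀ n : ℕ, lqSum μ q n ≤ K * 2 ^ (β * n)) : lqUpper μ q < (γ : EReal) := by
  have hK0 : 0 < K := by
    have h1 := (one_le_lqSum hμ hq hq1 0).trans (hK 0)
    simp at h1
    linarith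
  have hl2 : 0 < Real.log 2 := Real.log_pos (by norm_num)
  refine lt_of_le_of_lt (b := (((β + γ) / 2 : ℝ) : EReal)) ?_
    (EReal.coe_lt_coe_iff.2 (by linarith))
  refine limsup_le_of_le (h := ?_)
  filter_upwards [eventually_ge_atTop 1, tendsto_natCast_atTop_atTop.eventually
    (eventually_ge_atTop (2 * Real.log K / ((γ - β) * Real.log 2)))] with n hn1 hn
  have hn0 : (0 : ℝ) < n := by exact_mod_cast hn1
  rw [EReal.coe_le_coe_iff, inv_mul_le_iff₀ (by positivity)]
  have h1 : Real.log (lqSum μ q n) ≤ Real.log (K * 2 ^ (β * n)) :=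
    Real.log_le_log (one_pos.trans_le (one_le_lqSum hμ hq hq1 n)) (hK n)
  rw [Real.log_mul hK0.ne' (by positivity), Real.log_rpow (by norm_num)] at h1
  rw [div_le_iff₀ (mul_pos (by linarith) hl2)] at hn
  linarith

lemma lqUpper_lt_of_lt_one {c : Torus} {μ : Measure Torus} (hμ : IsGMeasure c μ) {q γ : ℝ}
    (hq : 0 < q) (hq1 : q ≤ 1) (hγ : 1 - q < γ) : lqUpper μ q < (γ : EReal) := by
  have := hμ.1
  refine lqUpper_lt_of_lqSum_le hμ hq hq1 (K := 4) hγ fun n => (lqSum_le μ hq hq1 n).trans ?_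
  have h2 : (0 : ℝ) < 2 ^ n := by positivity
  set P := fun k => (μ.map circleToReal).real (dyadic n k)
  have hP : ∀ k, 0 ≤ P k := fun k => measureReal_nonneg
  have hb : ∀ k, P k ^ q ≤ (2 ^ n) ^ (-q) * (1 + 2 ^ n * P k) := by
    intro k
    rw [Real.rpow_neg h2.le, ← div_eq_inv_mul, le_div_iff₀ (by positivity), mul_comm,
      ← Real.mul_rpow h2.le (hP k)]
    have hx : 0 ≤ 2 ^ n * P k := mul_nonneg h2.le (hP k)
    calc (2 ^ n * P k) ^ q ≤ (1 + 2 ^ n * P k) ^ q :=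
          Real.rpow_le_rpow hx (by linarith) hq.le
      _ ≤ (1 + 2 ^ n * P k) ^ (1 : ℝ) := Real.rpow_le_rpow_of_exponent_le (by linarith) hq1
      _ = _ := Real.rpow_one _
  calc 2 * ∑ k ∈ Finset.range (2 ^ n), P k ^ q
      ≤ 2 * ∑ k ∈ Finset.range (2 ^ n), (2 ^ n) ^ (-q) * (1 + 2 ^ n * P k) := by
        gcongr with k hk; exact hb k
    _ = 4 * (2 ^ n * (2 ^ n) ^ (-q)) := by
        rw [← Finset.mul_sum, Finset.sum_add_distrib, ← Finset.mul_sum,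
          hμ.isRealGMeasure.sum_measureReal_dyadic n]
        simp only [Finset.sum_const, Finset.card_range, nsmul_eq_mul]
        push_cast
        ring
    _ = 4 * 2 ^ ((1 - q) * n) := by
        nth_rw 1 [← Real.rpow_one ((2 : ℝ) ^ n)]
        rw [← Real.rpow_add h2, ← Real.rpow_natCast, ← Real.rpow_mul (by norm_num)]
        ring_nf

lemma exists_sum_le_of_lqUpper_lt {μ : Measure Torus} [IsProbabilityMeasure μ] {q r : ℝ}
    (hq : 0 < q) (hlt : lqUpper μ q < ((r * q : ℝ) : EReal)) :
    ∃ S, ∀ N, ∑ n ∈ Finset.range N, ∑ k ∈ Finset.range (2 ^ n),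
      ((μ.map circleToReal).real (dyadic n k) * 2 ^ (-(r * n))) ^ q ≤ S := by
  obtain ⟨β, hβ1, hβ2⟩ := EReal.lt_iff_exists_real_btwn.1 hlt
  rw [EReal.coe_lt_coe_iff] at hβ2
  have hl2 : 0 < Real.log 2 := Real.log_pos (by norm_num)
  set f : ℕ → ℝ := fun n => ∑ k ∈ Finset.range (2 ^ n),
      ((μ.map circleToReal).real (dyadic n k) * 2 ^ (-(r * n))) ^ q
  have hf0 : ∀ n, 0 ≤ f n := fun n => Finset.sum_nonneg fun k _ => by positivity
  have hθ : (2 : ℝ) ^ (β - r * q) < 1 :=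
    Real.rpow_lt_one_of_one_lt_of_neg (by norm_num) (by linarith)
  have hsum : Summable f := by
    refine (summable_geometric_of_lt_one (by positivity) hθ).of_norm_bounded_eventually_nat ?_
    filter_upwards [eventually_lt_of_limsup_lt hβ1, eventually_ge_atTop 1] with n hn hn1
    have hn0 : (0 : ℝ) < n := by exact_mod_cast hn1
    rw [EReal.coe_lt_coe_iff, inv_mul_lt_iff₀ (by positivity)] at hn
    have hL : lqSum μ q n ≤ 2 ^ (β * n) := by
      rcases le_or_gt (lqSum μ q n) 0 with h0 | h0
      · exact h0.trans (by positivity)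
      · rw [← Real.log_le_log_iff h0 (by positivity), Real.log_rpow (by norm_num)]
        linarith
    rw [Real.norm_of_nonneg (hf0 n)]
    calc f n = 2 ^ (-(r * n * q)) *
          ∑ k ∈ Finset.range (2 ^ n), (μ.map circleToReal).real (dyadic n k) ^ q := by
          rw [Finset.mul_sum]
          refine Finset.sum_congr rfl fun k _ => ?_
          rw [Real.mul_rpow measureReal_nonneg (by positivity), ← Real.rpow_mul (by norm_num),
            mul_comm]
          ring_nf
      _ ≤ 2 ^ (-(r * n * q)) * 2 ^ (β * n) := by
          gcongr
          exact (sum_dyadic_le_lqSum μ hq.le n).trans hL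
      _ = (2 ^ (β - r * q)) ^ n := by
          rw [← Real.rpow_add (by norm_num), ← Real.rpow_natCast (2 ^ (β - r * q)),
            ← Real.rpow_mul (by norm_num)]
          ring_nf
  exact ⟨∑' n, f n, fun N => hsum.sum_le_tsum _ fun n _ => hf0 n⟩

lemma frequently_le_sum_of_le_lqUpper {c : Torus} {μ : Measure Torus} (hμ : IsGMeasure c μ)
    {q γ : ℝ} (hq : 0 < q) (hq1 : q ≤ 1) (hle : (γ : EReal) ≤ lqUpper μ q) {η : ℝ} (hη : 0 < η) :
    ∃ᶠ m : ℕ in atTop, (2 : ℝ) ^ (m * (γ - η)) ≤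
      ∑ a ∈ Finset.range (2 ^ m), (μ.map circleToReal).real (dyadic m a) ^ q := by
  have := hμ.1
  have hl2 : 0 < Real.log 2 := Real.log_pos (by norm_num)
  have hlt : ((γ - η / 2 : ℝ) : EReal) < lqUpper μ q :=
    lt_of_lt_of_le (EReal.coe_lt_coe_iff.2 (by linarith)) hle
  refine ((frequently_lt_of_lt_limsup (h := hlt)).and_eventually
    ((eventually_ge_atTop 1).and (tendsto_natCast_atTop_atTop.eventually
      (eventually_ge_atTop (2 / η))))).mono ?_
  rintro n ⟨hn, hn1, hnη⟩
  have hn0 : (0 : ℝ) < n := by exact_mod_cast hn1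
  rw [EReal.coe_lt_coe_iff, lt_inv_mul_iff₀ (by positivity)] at hn
  rw [div_le_iff₀ hη] at hnη
  have hL : (2 : ℝ) ^ (n * (γ - η / 2)) ≤ lqSum μ q n := by
    rw [← Real.log_le_log_iff (by positivity) (one_pos.trans_le (one_le_lqSum hμ hq hq1 n)),
      Real.log_rpow (by norm_num)]
    linarith
  have h2 := hL.trans (lqSum_le μ hq hq1 n)
  have h3 : 2 * (2 : ℝ) ^ (n * (γ - η)) ≤ 2 ^ (n * (γ - η / 2)) := by
    nth_rw 1 [← Real.rpow_one (2 : ℝ)]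
    rw [← Real.rpow_add (by norm_num)]
    apply Real.rpow_le_rpow_of_exponent_le (by norm_num)
    linarith
  linarith

lemma sin_pi_mul_eq_prod (n : ℕ) (x : ℝ) :
    Real.sin (Real.pi * x) = 2 ^ n * Real.sin (Real.pi * (x / 2 ^ n)) *
      ∏ j ∈ Finset.range n, Real.cos (Real.pi * (x / 2 ^ (j + 1))) := by
  induction n with
  | zero => simp
  | succ n ih =>
    rw [ih, Finset.prod_range_succ]
    have e : Real.pi * (x / 2 ^ n) = 2 * (Real.pi * (x / 2 ^ (n + 1))) := by
      rw [pow_succ]; field_simp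
    rw [e, Real.sin_two_mul]
    ring

lemma le_weight_zero (n : ℕ) {x : ℝ} (hx : x ∈ Ico (0 : ℝ) 1) :
    (Real.sin (Real.pi * x) / Real.pi) ^ 2 ≤ weight 0 n 0 x := by
  have hpi := Real.pi_pos
  have hw : weight 0 n 0 x =
      (∏ j ∈ Finset.range n, Real.cos (Real.pi * (x / 2 ^ (j + 1)))) ^ 2 := by
    simp [weight, gReal, Finset.prod_pow]
  have hs : (2 ^ n * Real.sin (Real.pi * (x / 2 ^ n))) ^ 2 ≤ Real.pi ^ 2 := by
    have h2 : (0 : ℝ) < 2 ^ n := by positivity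
    apply sq_le_sq'
    · have := Real.sin_nonneg_of_nonneg_of_le_pi (x := Real.pi * (x / 2 ^ n))
        (mul_nonneg hpi.le (div_nonneg hx.1 h2.le))
        (mul_le_of_le_one_right hpi.le
          ((div_le_one h2).2 (hx.2.le.trans (one_le_pow₀ (by norm_num)))))
      nlinarith [mul_nonneg h2.le this]
    · have h1 : Real.sin (Real.pi * (x / 2 ^ n)) ≤ Real.pi * (x / 2 ^ n) :=
        Real.sin_le (mul_nonneg hpi.le (div_nonneg hx.1 h2.le))
      calc _ ≤ 2 ^ n * (Real.pi * (x / 2 ^ n)) := by gcongr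
        _ = Real.pi * x := by field_simp
        _ ≤ Real.pi := mul_le_of_le_one_right hpi.le hx.2.le
  rw [sin_pi_mul_eq_prod n x, hw, div_pow, mul_pow, div_le_iff₀ (by positivity), mul_comm]
  gcongr

lemma weight_zero_zero (n : ℕ) : weight 0 n 0 0 = 1 := by simp [weight, gReal]

lemma Ico_eq_insert_Ioo {a : ℝ} (ha : 0 < a) : Ico 0 a = {0} ∪ Ioo 0 a := by
  rw [singleton_union, Ioo_insert_left ha]

lemma IsRealGMeasure.measure_Ioo_eq_zero {ν : Measure ℝ} (h : IsRealGMeasure 0 ν) :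
    ν (Ioo 0 1) = 0 := by
  have := h.prob
  set g : ℝ → ℝ := fun x => (Real.sin (Real.pi * x) / Real.pi) ^ 2
  have hgc : Continuous g := by fun_prop
  have hg0 : ∀ x, 0 ≤ g x := fun x => sq_nonneg _
  have hgint : IntegrableOn g (Ioo 0 1) ν :=
    (hgc.continuousOn.integrableOn_compact (isCompact_Icc (a := (0 : ℝ)) (b := 1))).mono_set
      Ioo_subset_Icc_self
  have hlow : ∀ n, ν.real {0} + ∫ x in Ioo 0 1, g x ∂ν ≤ ν.real (dyadic n 0) := by
    intro n
    have hd : Disjoint ({0} : Set ℝ) (Ioo 0 1) := by simp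
    rw [h.measureReal_dyadic (by positivity), Ico_eq_insert_Ioo one_pos,
      setIntegral_union hd measurableSet_Ioo (integrable_weight _ _).integrableOn
        (integrable_weight _ _).integrableOn, integral_singleton, weight_zero_zero]
    simp only [smul_eq_mul, mul_one]
    exact add_le_add le_rfl (setIntegral_mono_on hgint (integrable_weight _ _).integrableOn
      measurableSet_Ioo fun x hx => le_weight_zero n ⟨hx.1.le, hx.2⟩)
  have hlim : Tendsto (fun n => ν.real (dyadic n 0)) atTop (𝓝 (ν.real {0})) := by
    have hI : ⋂ n, dyadic n 0 = {0} := by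
      ext x
      simp only [mem_iInter, mem_singleton_iff, dyadic, mem_Ico, Nat.cast_zero, zero_div, zero_add]
      constructor
      · intro hx
        refine le_antisymm ?_ (hx 0).1
        refine ge_of_tendsto' (tendsto_pow_atTop_nhds_zero_of_lt_one (r := (1 / 2 : ℝ))
          (by norm_num) (by norm_num)) fun n => ?_
        rw [div_pow, one_pow]
        exact (hx n).2.le
      · rintro rfl n
        exact ⟨le_rfl, by positivity⟩
    rw [← hI]
    refine (ENNReal.tendsto_toReal (measure_ne_top _ _)).comp
      (tendsto_measure_iInter_atTop
        (fun n => (measurableSet_dyadic n 0).nullMeasurableSet) ?_ ⟨0, measure_ne_top _ _⟩)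
    intro m n hmn
    refine Ico_subset_Ico (by simp) ?_
    gcongr
    norm_num
  have hle := ge_of_tendsto' hlim hlow
  have hzero : ∫ x in Ioo 0 1, g x ∂ν = 0 :=
    le_antisymm (by linarith) (setIntegral_nonneg measurableSet_Ioo fun x _ => hg0 x)
  rw [setIntegral_eq_zero_iff_of_nonneg_ae (Eventually.of_forall hg0) hgint] at hzero
  have hz := (ae_restrict_iff' measurableSet_Ioo).1 hzero
  refine measure_mono_null (fun x hx => ?_) hz
  simp only [mem_compl_iff, mem_ofPred_eq, Classical.not_imp]
  refine ⟨hx, ?_⟩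
  have := Real.sin_pos_of_pos_of_lt_pi (mul_pos Real.pi_pos hx.1)
    (mul_lt_of_lt_one_right Real.pi_pos hx.2)
  have := Real.pi_pos
  simp only [g, Pi.zero_apply]
  positivity

lemma lqSum_le_two {c : Torus} {μ : Measure Torus} (hμ : IsGMeasure c μ)
    (hc : circleToReal c = 0) {q : ℝ} (hq : 0 < q) (hq1 : q ≤ 1) (n : ℕ) : lqSum μ q n ≤ 2 := by
  have := hμ.1
  have h := hμ.isRealGMeasure
  rw [hc] at h
  have := h.prob
  refine (lqSum_le μ hq hq1 n).trans ?_
  rw [Finset.sum_eq_single_of_mem 0 (by simp)]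
  · have : ((μ.map circleToReal).real (dyadic n 0)) ^ q ≤ 1 :=
      Real.rpow_le_one measureReal_nonneg measureReal_le_one hq.le
    linarith
  · intro k hk hk0
    have hsub : dyadic n k ⊆ Ioo 0 1 := fun x hx =>
      ⟨lt_of_lt_of_le (div_pos (by exact_mod_cast Nat.pos_of_ne_zero hk0) (by positivity)) hx.1,
        (dyadic_subset (Finset.mem_range.1 hk) hx).2⟩
    rw [measureReal_def, measure_mono_null hsub h.measure_Ioo_eq_zero]
    simp [hq.ne']

lemma tendsto_log_natCast : Tendsto (fun n : ℕ => Real.log n) atTop atTop :=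
  Real.tendsto_log_atTop.comp tendsto_natCast_atTop_atTop

lemma log_mul_rpow_natCast {b κ : ℝ} (hb : 0 < b) {n : ℕ} (hn : 1 ≤ n) :
    Real.log (b * (n : ℝ) ^ (-κ)) = Real.log b - κ * Real.log n := by
  have hn0 : (0 : ℝ) < n := by exact_mod_cast hn
  rw [Real.log_mul hb.ne' (by positivity), Real.log_rpow hn0]
  ring

lemma eventually_lt_one_of_le {e : ℕ → ℝ} {b κ : ℝ} (hb : 0 < b) (hκ : 0 < κ)
    (h : ∀ᶠ n : ℕ in atTop, e n ≤ b * (n : ℝ) ^ (-κ)) : ∀ᶠ n : ℕ in atTop, e n < 1 := by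
  filter_upwards [h, eventually_ge_atTop 1,
    tendsto_log_natCast.eventually (eventually_gt_atTop (Real.log b / κ))] with n hn hn1 hlog
  have hn0 : (0 : ℝ) < n := by exact_mod_cast hn1
  refine hn.trans_lt ?_
  rw [← Real.log_neg_iff (by positivity), log_mul_rpow_natCast hb hn1]
  rw [div_lt_iff₀ hκ] at hlog
  linarith

lemma eventually_dim_lt {e : ℕ → ℝ} {b κ a : ℝ} (he : ∀ n, 0 ≤ e n) (hb : 0 < b) (hκ : 0 < κ)
    (ha : 1 < a * κ) (h : ∀ᶠ n : ℕ in atTop, e n ≤ b * (n : ℝ) ^ (-κ)) :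
    ∀ᶠ n : ℕ in atTop, -Real.log n / Real.log (e n) < a := by
  have ha0 : 0 < a := pos_of_mul_pos_left (one_pos.trans ha) hκ.le
  filter_upwards [h, eventually_lt_one_of_le hb hκ h, eventually_ge_atTop 1,
    tendsto_log_natCast.eventually (eventually_gt_atTop (a * Real.log b / (a * κ - 1)))]
    with n hn hn1 hn2 hlog
  rcases (he n).eq_or_lt with h0 | h0
  · simpa [← h0] using ha0
  · have h1 := Real.log_le_log h0 hn
    rw [log_mul_rpow_natCast hb hn2] at h1
    have h2 : Real.log (e n) < 0 := Real.log_neg h0 hn1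
    rw [div_lt_iff₀ (by linarith)] at hlog
    rw [div_lt_iff_of_neg h2]
    nlinarith

lemma eventually_lt_dim {e : ℕ → ℝ} {b κ a : ℝ} (hb : 0 < b) (ha : a * κ < 1)
    (h1 : ∀ᶠ n : ℕ in atTop, e n < 1)
    (h : ∀ᶠ n : ℕ in atTop, b * (n : ℝ) ^ (-κ) ≤ e n) :
    ∀ᶠ n : ℕ in atTop, a < -Real.log n / Real.log (e n) := by
  filter_upwards [h, h1, eventually_ge_atTop 2,
    tendsto_log_natCast.eventually (eventually_gt_atTop (-(a * Real.log b) / (1 - a * κ)))]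
    with n hn hn1 hn2 hlog
  have hn0 : (0 : ℝ) < n := by positivity
  have hpos : 0 < b * (n : ℝ) ^ (-κ) := by positivity
  have h3 := Real.log_le_log hpos hn
  rw [log_mul_rpow_natCast hb (by omega)] at h3
  have h2 : Real.log (e n) < 0 := Real.log_neg (hpos.trans_le hn) hn1
  have hln : 0 < Real.log n := Real.log_pos (by exact_mod_cast hn2)
  rw [div_lt_iff₀ (by linarith)] at hlog
  rw [lt_div_iff_of_neg h2]
  rcases le_or_gt a 0 with h0 | h0 <;> nlinarith

/-- for a `g`-measure `μ` for `g^c`, regarded as a measure on `[0,1] ⊂ ℝ`,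
the quantization dimension of order `r > 0` exists and equals `r q_r / (1 − q_r)` with
`q_r = inf {q > 0 : β̄_μ(q) < r q}`. -/
theorem stmt12 (c : Torus) (μ : Measure Torus) (hμ : IsGMeasure c μ) (r : ℝ) (hr : 0 < r) :
    Tendsto
      (fun n : ℕ => -Real.log n / Real.log (quantErr (μ.map circleToReal) r n)) atTop
      (𝓝 (r * sInf {q : ℝ | 0 < q ∧ lqUpper μ q < ((r * q : ℝ) : EReal)} /
          (1 - sInf {q : ℝ | 0 < q ∧ lqUpper μ q < ((r * q : ℝ) : EReal)}))) := by
  have := hμ.1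
  have h := hμ.isRealGMeasure
  have := h.prob
  set S := {q : ℝ | 0 < q ∧ lqUpper μ q < ((r * q : ℝ) : EReal)} with hS
  set q₀ := sInf S
  have hbdd : BddBelow S := ⟨0, fun q hq => hq.1.le⟩
  have hq₀0 : 0 ≤ q₀ := Real.sInf_nonneg fun q hq => hq.1.le
  obtain ⟨q₁, hq₁, hq₁1⟩ : ∃ q ∈ S, q < 1 := by
    have h1 : 1 / (1 + r) < 1 := (div_lt_one (by positivity)).2 (by linarith)
    obtain ⟨q, hq, hq1⟩ := exists_between h1
    have hq0 : 0 < q := lt_trans (by positivity) hq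
    rw [div_lt_iff₀ (by positivity)] at hq
    exact ⟨q, ⟨hq0, lqUpper_lt_of_lt_one hμ hq0 hq1.le (by linarith)⟩, hq1⟩
  have hq₀1 : q₀ < 1 := (csInf_le hbdd hq₁).trans_lt hq₁1
  set D : ℝ → ℝ := fun q => r * q / (1 - q) with hD
  have hcont : ContinuousAt D q₀ :=
    ContinuousAt.div (by fun_prop) (by fun_prop) (by linarith)
  have hDκ : ∀ {a q : ℝ}, 0 < q → q < 1 → D q < a → 1 < a * ((1 - q) / (r * q)) := by
    intro a q hq hq1 ha
    rw [hD, div_lt_iff₀ (by linarith)] at ha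
    rwa [← mul_div_assoc, one_lt_div (by positivity)]
  have hκD : ∀ {a q : ℝ}, 0 < q → q < 1 → a < D q → a * ((1 - q) / (r * q)) < 1 := by
    intro a q hq hq1 ha
    rw [hD, lt_div_iff₀ (by linarith)] at ha
    rwa [← mul_div_assoc, div_lt_one (by positivity)]
  have hupper : ∀ q ∈ S, q < 1 → ∃ b > 0, ∀ᶠ n : ℕ in atTop,
      quantErr (μ.map circleToReal) r n ≤ b * (n : ℝ) ^ (-((1 - q) / (r * q))) := by
    intro q hq hq1
    obtain ⟨K, hK⟩ := exists_sum_le_of_lqUpper_lt hq.1 hq.2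
    exact exists_quantErr_le h.ae_mem hr hq.1 hK
  have hone : ∀ᶠ n : ℕ in atTop, quantErr (μ.map circleToReal) r n < 1 := by
    obtain ⟨b, hb, hle⟩ := hupper q₁ hq₁ hq₁1
    exact eventually_lt_one_of_le hb
      (div_pos (by linarith) (mul_pos hr hq₁.1)) hle
  change Tendsto _ atTop (𝓝 (D q₀))
  refine tendsto_order.2 ⟨fun a ha => ?_, fun a ha => ?_⟩
  · rcases hq₀0.eq_or_lt with h0 | h0
    · have ha0 : a < 0 := by simpa [hD, ← h0] using ha
      filter_upwards [hone, eventually_ge_atTop 1] with n hn hn1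
      refine ha0.trans_le (div_nonneg_of_nonpos ?_ ?_)
      · exact neg_nonpos.2 (Real.log_nonneg (by exact_mod_cast hn1))
      · exact Real.log_nonpos (quantErr_nonneg _ _ _) hn.le
    · have hc : circleToReal c ∈ Ioo (0 : ℝ) 1 := by
        refine ⟨lt_of_le_of_ne (circleToReal_mem c).1 fun hc => ?_, (circleToReal_mem c).2⟩
        have hmem : q₀ / 2 ∈ S := by
          have hq : 0 < q₀ / 2 := by linarith
          refine ⟨hq, lqUpper_lt_of_lqSum_le hμ hq (by linarith) (K := 2) (mul_pos hr hq)
            fun n => ?_⟩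
          simpa using lqSum_le_two hμ hc.symm hq (by linarith) n
        linarith [csInf_le hbdd hmem]
      have hev : ∀ᶠ q in 𝓝[<] q₀, a < D q ∧ 0 < q :=
        nhdsWithin_le_nhds ((hcont.eventually (lt_mem_nhds ha)).and (lt_mem_nhds h0))
      obtain ⟨q', ⟨ha', hq'0⟩, hq'⟩ := (hev.and self_mem_nhdsWithin).exists
      obtain ⟨q, hq'q, hq⟩ := exists_between (show q' < q₀ from hq')
      have hq0 : 0 < q := hq'0.trans hq'q
      have hnot : ((r * q : ℝ) : EReal) ≤ lqUpper μ q := by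
        by_contra! hlt
        linarith [csInf_le hbdd (show q ∈ S from ⟨hq0, hlt⟩)]
      obtain ⟨b, hb, hle⟩ := h.exists_le_quantErr hc hr hq'0 hq'q fun η hη =>
        frequently_le_sum_of_le_lqUpper hμ hq0 (by linarith) hnot hη
      exact eventually_lt_dim hb (hκD hq'0 (by linarith) ha') hone
        ((eventually_ge_atTop 1).mono hle)
  · obtain ⟨u, hu, hIco⟩ := (mem_nhdsGE_iff_exists_Ico_subset' hq₀1).1
      (nhdsWithin_le_nhds (hcont.eventually (gt_mem_nhds ha)))
    obtain ⟨q, hq, hqu⟩ := exists_lt_of_csInf_lt ⟨q₁, hq₁⟩ (lt_min hu hq₀1)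
    have hq1 : q < 1 := hqu.trans_le (min_le_right _ _)
    have hqa : D q < a := hIco ⟨csInf_le hbdd hq, hqu.trans_le (min_le_left _ _)⟩
    obtain ⟨b, hb, hle⟩ := hupper q hq hq1
    exact eventually_dim_lt (fun n => quantErr_nonneg _ _ _) hb
      (div_pos (by linarith) (mul_pos hr hq.1)) (hDκ hq.1 hq1 hqa) hle

end GTM
end
end

section
/- Let ν be a Borel probability measure on the torus 𝕋 with full topological support, and assume that for every q ∈ ℝ the limit β_ν(q) exists, i.e. β̄_ν(q) = β̲_ν(q) in ℝ ∪ {+∞}. Let β*(a) = sup_{q∈ℝ} (q·a − β_ν(q)). Then for every α ∈ ℝ, the Hausdorff dimension of {x ∈ 𝕋 : d_ν(x) = α} is at most max{−β*(−α), 0}. -/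
open MeasureTheory Filter Topology Set
open scoped ENNReal

noncomputable section

namespace GTM

/-- The local dimension of `ν` at `x` equals `α`:
`lim_{r ↘ 0} log ν(B_r(x)) / log r = α` (closed balls). -/
def HasLocDim (ν : Measure Torus) (x : Torus) (α : ℝ) : Prop :=
  Tendsto (fun r : ℝ => Real.log (ν (Metric.closedBall x r)).toReal / Real.log r)
    (𝓝[>] (0 : ℝ)) (𝓝 α)

/-- Conversion `EReal → ℝ≥0∞` (sending `⊤ ↦ ∞` and negatives to `0`). -/
def erealToENNReal (x : EReal) : ℝ≥0∞ :=
  if x = ⊤ then ⊤ else ENNReal.ofReal x.toReal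

/-- The image in `𝕋` of the dyadic interval of `ω` enlarged by `2⁻ⁿ` on each side. -/
def wideCyl (n : ℕ) (ω : Fin n → Bool) : Set Torus :=
  (fun x : ℝ => (x : Torus)) '' Set.Icc (wordVal n ω - 1 / 2 ^ n) (wordVal n ω + 2 * (1 / 2 ^ n))

lemma exists_wordVal_eq (n k : ℕ) (hk : k < 2 ^ n) :
    ∃ ω : Fin n → Bool, wordVal n ω = k * (1 / 2 ^ n) := by
  induction n generalizing k with
  | zero =>
    obtain rfl : k = 0 := by simpa using hk
    exact ⟨fun _ => false, by simp [wordVal]⟩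
  | succ n ih =>
    obtain ⟨ω, hω⟩ := ih (k / 2) (by rw [pow_succ] at hk; omega)
    refine ⟨Fin.snoc ω (decide (k % 2 = 1)), ?_⟩
    have hsum : wordVal (n + 1) (Fin.snoc ω (decide (k % 2 = 1))) =
        wordVal n ω + (if k % 2 = 1 then (1 : ℝ) else 0) / 2 ^ (n + 1) := by
      simp [wordVal, Fin.sum_univ_castSucc]
    have hdiv : (k : ℝ) = 2 * ((k / 2 : ℕ) : ℝ) + (if k % 2 = 1 then (1 : ℝ) else 0) := by
      have h : k = 2 * (k / 2) + (if k % 2 = 1 then 1 else 0) := by split_ifs <;> omega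
      conv_lhs => rw [h]
      push_cast
      rfl
    rw [hsum, hω]
    conv_rhs => rw [hdiv]
    field_simp
    ring

lemma exists_int_translate_wordVal (n : ℕ) (m : ℤ) :
    ∃ (ω : Fin n → Bool) (a : ℤ), (m : ℝ) * (1 / 2 ^ n) = wordVal n ω + a := by
  have hpos : (0 : ℤ) < 2 ^ n := by positivity
  have hlt := Int.emod_lt_of_pos m hpos
  have hnn := Int.emod_nonneg m hpos.ne'
  obtain ⟨k, hk⟩ := Int.eq_ofNat_of_zero_le hnn
  obtain ⟨ω, hω⟩ := exists_wordVal_eq n k (by rw [hk] at hlt; exact_mod_cast hlt)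
  refine ⟨ω, m / 2 ^ n, ?_⟩
  have h : (m : ℝ) = 2 ^ n * ((m / 2 ^ n : ℤ) : ℝ) + k := by
    have h := Int.mul_ediv_add_emod m (2 ^ n)
    rw [hk] at h
    exact_mod_cast h.symm
  rw [hω]
  conv_lhs => rw [h]
  field_simp
  ring

lemma coe_sub_intCast (z : ℝ) (a : ℤ) : ((z - a : ℝ) : Torus) = (z : Torus) := by
  have h : ((a : ℝ) : Torus) = 0 := (AddCircle.coe_eq_zero_iff 1).2 ⟨a, by simp⟩
  rw [AddCircle.coe_sub, h, sub_zero]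

lemma exists_abs_sub_le_of_mem_closedBall {y r : ℝ} {z : Torus}
    (hz : z ∈ Metric.closedBall (y : Torus) r) : ∃ z' : ℝ, (z' : Torus) = z ∧ |z' - y| ≤ r := by
  obtain ⟨w, rfl⟩ := QuotientAddGroup.mk_surjective z
  have hz : dist (w : Torus) (y : Torus) ≤ r := hz
  rw [dist_eq_norm, ← AddCircle.coe_sub, AddCircle.norm_eq] at hz
  refine ⟨w - round (w - y), coe_sub_intCast _ _, ?_⟩
  simp only [inv_one, one_mul, mul_one] at hz
  rwa [show w - round (w - y) - y = w - y - round (w - y) by ring]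

lemma dist_coe_le (y z : ℝ) : dist (y : Torus) (z : Torus) ≤ |y - z| := by
  rw [dist_eq_norm, ← AddCircle.coe_sub]
  exact QuotientAddGroup.norm_mk_le_norm

lemma cyl_subset_closedBall {n : ℕ} {ω : Fin n → Bool} {x : Torus} (hx : x ∈ cyl n ω) :
    cyl n ω ⊆ Metric.closedBall x (1 / 2 ^ n) := by
  obtain ⟨y, hy, rfl⟩ := hx
  rintro _ ⟨z, hz, rfl⟩
  refine (dist_coe_le z y).trans ?_
  rw [abs_le]
  constructor <;> linarith [hy.1, hy.2, hz.1, hz.2]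

lemma cyl_subset_wideCyl (n : ℕ) (ω : Fin n → Bool) : cyl n ω ⊆ wideCyl n ω := by
  have h : (0 : ℝ) < 1 / 2 ^ n := by positivity
  exact Set.image_mono (Set.Icc_subset_Icc (by linarith) (by linarith))

lemma ediam_wideCyl_le (n : ℕ) (ω : Fin n → Bool) :
    Metric.ediam (wideCyl n ω) ≤ ENNReal.ofReal (3 * (1 / 2 ^ n)) := by
  have hlip : LipschitzWith 1 (fun x : ℝ => (x : Torus)) :=
    LipschitzWith.mk_one fun y z => dist_coe_le y z
  refine (hlip.ediam_image_le _).trans ?_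
  rw [Real.ediam_Icc, ENNReal.coe_one, one_mul]
  exact ENNReal.ofReal_le_ofReal (by linarith)

lemma exists_cyl_of_real (n : ℕ) (y : ℝ) (m : ℤ) (h1 : (m - 1) * (1 / 2 ^ n) ≤ y)
    (h2 : y ≤ (m + 2) * (1 / 2 ^ n)) : ∃ ω : Fin n → Bool, (y : Torus) ∈ wideCyl n ω ∧
      ∀ z : ℝ, m * (1 / 2 ^ n) ≤ z → z ≤ (m + 1) * (1 / 2 ^ n) → (z : Torus) ∈ cyl n ω := by
  obtain ⟨ω, a, h⟩ := exists_int_translate_wordVal n m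
  refine ⟨ω, ⟨y - a, ⟨by linarith, by linarith⟩, coe_sub_intCast _ _⟩, fun z hz1 hz2 => ?_⟩
  exact ⟨z - a, ⟨by linarith, by linarith⟩, coe_sub_intCast _ _⟩

lemma exists_floor_bounds (n : ℕ) (y : ℝ) :
    ∃ j : ℤ, (j : ℝ) * (1 / 2 ^ n) ≤ y ∧ y ≤ (j + 1) * (1 / 2 ^ n) := by
  have hp : (0 : ℝ) < 2 ^ n := by positivity
  refine ⟨⌊y * 2 ^ n⌋, ?_, ?_⟩
  · rw [mul_one_div, div_le_iff₀ hp]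
    exact Int.floor_le _
  · rw [mul_one_div, le_div_iff₀ hp]
    exact (Int.lt_floor_add_one _).le

lemma exists_mem_cyl (n : ℕ) (x : Torus) : ∃ ω : Fin n → Bool, x ∈ cyl n ω := by
  obtain ⟨y, rfl⟩ := QuotientAddGroup.mk_surjective x
  obtain ⟨j, hj1, hj2⟩ := exists_floor_bounds n y
  have h : (0 : ℝ) < 1 / 2 ^ n := by positivity
  obtain ⟨ω, -, hω⟩ := exists_cyl_of_real n y j (by linarith) (by linarith)
  exact ⟨ω, hω y hj1 hj2⟩

lemma exists_closedBall_subset_union_cyl (n : ℕ) (x : Torus) :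
    ∃ ω₁ ω₂ ω₃ : Fin n → Bool, x ∈ wideCyl n ω₁ ∧ x ∈ wideCyl n ω₂ ∧ x ∈ wideCyl n ω₃ ∧
      Metric.closedBall x (1 / 2 ^ n) ⊆ cyl n ω₁ ∪ cyl n ω₂ ∪ cyl n ω₃ := by
  obtain ⟨y, rfl⟩ := QuotientAddGroup.mk_surjective x
  obtain ⟨j, hj1, hj2⟩ := exists_floor_bounds n y
  have h : (0 : ℝ) < 1 / 2 ^ n := by positivity
  obtain ⟨ω₁, hx₁, hω₁⟩ := exists_cyl_of_real n y (j - 1)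
    (by push_cast; linarith) (by push_cast; linarith)
  obtain ⟨ω₂, hx₂, hω₂⟩ := exists_cyl_of_real n y j (by linarith) (by linarith)
  obtain ⟨ω₃, hx₃, hω₃⟩ := exists_cyl_of_real n y (j + 1)
    (by push_cast; linarith) (by push_cast; linarith)
  refine ⟨ω₁, ω₂, ω₃, hx₁, hx₂, hx₃, fun z hz => ?_⟩
  obtain ⟨z, rfl, hzy⟩ := exists_abs_sub_le_of_mem_closedBall hz
  rw [abs_le] at hzy
  push_cast at hω₁ hω₃
  rcases le_total z (j * (1 / 2 ^ n)) with hzj | hzj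
  · exact Or.inl (Or.inl (hω₁ z (by linarith) (by linarith)))
  · rcases le_total z ((j + 1) * (1 / 2 ^ n)) with hzj' | hzj'
    · exact Or.inl (Or.inr (hω₂ z hzj hzj'))
    · exact Or.inr (hω₃ z hzj' (by linarith))

section Measure

variable (ν : Measure Torus) [IsProbabilityMeasure ν]

lemma measure_cyl_toReal_pos (hsupp : ∀ U : Set Torus, IsOpen U → U.Nonempty → 0 < ν U)
    (n : ℕ) (ω : Fin n → Bool) : 0 < (ν (cyl n ω)).toReal := by
  refine ENNReal.toReal_pos (ne_of_gt ?_) (measure_ne_top _ _)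
  have h : (0 : ℝ) < 1 / 2 ^ n := by positivity
  refine (hsupp ((fun x : ℝ => (x : Torus)) ''
    Set.Ioo (wordVal n ω) (wordVal n ω + 1 / 2 ^ n)) ?_ ?_).trans_le
    (measure_mono (Set.image_mono Set.Ioo_subset_Icc_self))
  · exact QuotientAddGroup.isOpenMap_coe _ isOpen_Ioo
  · exact (Set.nonempty_Ioo.2 (by linarith)).image _

/-- Around a point of local dimension `α`, at every small dyadic scale some nearby dyadic interval
has mass whose `q`-th power is at least about `2^(-n q α)`. -/
lemma HasLocDim.eventually_exists_cyl
    (hsupp : ∀ U : Set Torus, IsOpen U → U.Nonempty → 0 < ν U)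
    {x : Torus} {α : ℝ} (hx : HasLocDim ν x α) (q : ℝ) {ε : ℝ} (hε : 0 < ε) :
    ∀ᶠ n : ℕ in atTop, ∃ ω : Fin n → Bool, x ∈ wideCyl n ω ∧
      -(n * Real.log 2 * (q * α + ε)) ≤ q * Real.log (ν (cyl n ω)).toReal := by
  have hl2 : 0 < Real.log 2 := Real.log_pos one_lt_two
  have hscale : Tendsto (fun n : ℕ => (1 : ℝ) / 2 ^ n) atTop (𝓝[>] 0) := by
    refine tendsto_nhdsWithin_iff.2 ⟨?_, Eventually.of_forall fun n => ?_⟩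
    · simpa [one_div_pow] using
        tendsto_pow_atTop_nhds_zero_of_lt_one (r := (1 / 2 : ℝ)) (by norm_num) (by norm_num)
    · exact Set.mem_Ioi.2 (by positivity)
  have hlim := hx.comp hscale
  set δ : ℝ := ε / (2 * (|q| + 1)) with hδ
  have hδpos : 0 < δ := by positivity
  have hqδ : |q| * δ ≤ ε / 2 := by
    rw [hδ, mul_div_assoc', div_le_div_iff₀ (by positivity) two_pos]
    nlinarith [abs_nonneg q]
  have hlarge : ∀ᶠ n : ℕ in atTop, |q| * Real.log 3 ≤ n * (Real.log 2 * (ε / 2)) :=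
    (tendsto_natCast_atTop_atTop.atTop_mul_const (by positivity)).eventually_ge_atTop _
  filter_upwards [Metric.tendsto_nhds.1 hlim δ hδpos, hlarge, eventually_gt_atTop 0]
    with n hn hlarge hn0
  have hL : 0 < (n : ℝ) * Real.log 2 := by positivity
  set L := (n : ℝ) * Real.log 2 with hLdef
  set B := Metric.closedBall x (1 / 2 ^ n) with hB
  have hlogr : Real.log (1 / 2 ^ n) = -L := by
    rw [one_div, Real.log_inv, Real.log_pow]
  have hn' : |Real.log (ν B).toReal / -L - α| < δ := by
    simpa [Real.dist_eq, hlogr, hB] using hn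
  have hM : Real.log (ν B).toReal = -(L * (Real.log (ν B).toReal / -L)) := by
    field_simp
  obtain ⟨hlow, hup⟩ := abs_lt.1 hn'
  have hBlow : -(L * (α + δ)) ≤ Real.log (ν B).toReal := by rw [hM]; nlinarith
  have hBup : Real.log (ν B).toReal ≤ -(L * (α - δ)) := by rw [hM]; nlinarith
  have hLq : L * (|q| * δ) ≤ L * (ε / 2) := mul_le_mul_of_nonneg_left hqδ hL.le
  rcases lt_or_ge q 0 with hq | hq
  · obtain ⟨ω, hω⟩ := exists_mem_cyl n x
    refine ⟨ω, cyl_subset_wideCyl n ω hω, ?_⟩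
    have hle : Real.log (ν (cyl n ω)).toReal ≤ -(L * (α - δ)) :=
      (Real.log_le_log (measure_cyl_toReal_pos ν hsupp n ω)
        (ENNReal.toReal_mono (measure_ne_top _ _)
          (measure_mono (cyl_subset_closedBall hω)))).trans hBup
    have hmul := mul_le_mul_of_nonpos_left hle hq.le
    rw [abs_of_neg hq] at hLq
    nlinarith [mul_pos hL hε]
  · obtain ⟨ω₁, ω₂, ω₃, hx₁, hx₂, hx₃, hsub⟩ := exists_closedBall_subset_union_cyl n x
    have hsum : (ν B).toReal ≤
        (ν (cyl n ω₁)).toReal + (ν (cyl n ω₂)).toReal + (ν (cyl n ω₃)).toReal := by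
      have h1 : ν.real B ≤ ν.real (cyl n ω₁ ∪ cyl n ω₂ ∪ cyl n ω₃) := measureReal_mono hsub
      have h2 := measureReal_union_le (μ := ν) (cyl n ω₁ ∪ cyl n ω₂) (cyl n ω₃)
      have h3 := measureReal_union_le (μ := ν) (cyl n ω₁) (cyl n ω₂)
      simp only [measureReal_def] at h1 h2 h3
      linarith
    have hBpos : 0 < (ν B).toReal := by
      obtain ⟨ω, hω⟩ := exists_mem_cyl n x
      exact (measure_cyl_toReal_pos ν hsupp n ω).trans_le
        (ENNReal.toReal_mono (measure_ne_top _ _) (measure_mono (cyl_subset_closedBall hω)))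
    obtain ⟨ω, hω, hheavy⟩ : ∃ ω : Fin n → Bool, x ∈ wideCyl n ω ∧
        (ν B).toReal / 3 ≤ (ν (cyl n ω)).toReal := by
      by_contra! hcon
      linarith [hcon ω₁ hx₁, hcon ω₂ hx₂, hcon ω₃ hx₃]
    refine ⟨ω, hω, ?_⟩
    have hle := Real.log_le_log (by positivity) hheavy
    rw [Real.log_div hBpos.ne' three_ne_zero] at hle
    have hmul := mul_le_mul_of_nonneg_left (show -(L * (α + δ)) - Real.log 3 ≤
      Real.log (ν (cyl n ω)).toReal by linarith) hq
    rw [abs_of_nonneg hq] at hLq hlarge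
    have hlarge' : q * Real.log 3 ≤ L * (ε / 2) := by rw [hLdef]; linarith
    linarith

/-- Counting bound for dyadic intervals of heavy `q`-weight. -/
lemma card_mul_exp_le_lqSum (hsupp : ∀ U : Set Torus, IsOpen U → U.Nonempty → 0 < ν U)
    (q c : ℝ) (n : ℕ) (S : Finset (Fin n → Bool))
    (hS : ∀ ω ∈ S, c ≤ q * Real.log (ν (cyl n ω)).toReal) :
    S.card * Real.exp c ≤ lqSum ν q n := by
  calc S.card * Real.exp c = ∑ _ω ∈ S, Real.exp c := by simp
    _ ≤ ∑ ω ∈ S, (ν (cyl n ω)).toReal ^ q := by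
      refine Finset.sum_le_sum fun ω hω => ?_
      rw [Real.rpow_def_of_pos (measure_cyl_toReal_pos ν hsupp n ω), mul_comm _ q]
      exact Real.exp_le_exp.2 (hS ω hω)
    _ ≤ lqSum ν q n :=
      Finset.sum_le_sum_of_subset_of_nonneg (Finset.subset_univ _) fun _ _ _ => by positivity

lemma lqSum_pos (hsupp : ∀ U : Set Torus, IsOpen U → U.Nonempty → 0 < ν U) (q : ℝ) (n : ℕ) :
    0 < lqSum ν q n :=
  Finset.sum_pos (fun ω _ => Real.rpow_pos_of_pos (measure_cyl_toReal_pos ν hsupp n ω) q)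
    Finset.univ_nonempty

lemma eventually_lqSum_le (hsupp : ∀ U : Set Torus, IsOpen U → U.Nonempty → 0 < ν U)
    {q b : ℝ} (hb : lqUpper ν q < b) :
    ∀ᶠ n : ℕ in atTop, lqSum ν q n ≤ Real.exp (n * Real.log 2 * b) := by
  filter_upwards [eventually_lt_of_limsup_lt hb, eventually_gt_atTop 0] with n hn hn0
  have hL : 0 < (n : ℝ) * Real.log 2 := by
    have := Real.log_pos one_lt_two
    positivity
  have hn := EReal.coe_lt_coe_iff.1 hn
  rw [inv_mul_lt_iff₀ hL] at hn
  exact (Real.log_le_iff_le_exp (lqSum_pos ν hsupp q n)).1 hn.le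

/-- If every scale past `N` offers a heavy cylinder near each point of `s`, then `s` has dimension
at most `t`. -/
lemma dimH_le_of_forall_exists_cyl
    (hsupp : ∀ U : Set Torus, IsOpen U → U.Nonempty → 0 < ν U) {q b c : ℝ} {t : NNReal}
    (hb : lqUpper ν q < b) (ht : c + b ≤ t) {s : Set Torus} {N : ℕ}
    (hs : ∀ x ∈ s, ∀ n ≥ N, ∃ ω : Fin n → Bool, x ∈ wideCyl n ω ∧
      -(n * Real.log 2 * c) ≤ q * Real.log (ν (cyl n ω)).toReal) :
    dimH s ≤ t := by
  classical
  let S : (n : ℕ) → Finset (Fin n → Bool) := fun n =>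
    Finset.univ.filter fun ω => -(n * Real.log 2 * c) ≤ q * Real.log (ν (cyl n ω)).toReal
  have hr : Tendsto (fun n : ℕ => ENNReal.ofReal (3 * (1 / 2 ^ n))) atTop (𝓝 0) := by
    rw [← ENNReal.ofReal_zero]
    refine ENNReal.tendsto_ofReal ?_
    simpa [one_div_pow] using
      (tendsto_pow_atTop_nhds_zero_of_lt_one (r := (1 / 2 : ℝ))
        (by norm_num) (by norm_num)).const_mul 3
  have hmeas := Measure.hausdorffMeasure_le_liminf_sum (t : ℝ) s
    (fun n : ℕ => ENNReal.ofReal (3 * (1 / 2 ^ n))) hr (fun n (ω : S n) => wideCyl n ω.1)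
    (Eventually.of_forall fun n ω => ediam_wideCyl_le n ω.1)
    (by
      filter_upwards [eventually_ge_atTop N] with n hn x hx
      obtain ⟨ω, hω, hle⟩ := hs x hx n hn
      exact Set.mem_iUnion.2 ⟨⟨ω, by simpa [S] using hle⟩, hω⟩)
  have hsum : ∀ᶠ n : ℕ in atTop, ∑ ω : S n, Metric.ediam (wideCyl n ω.1) ^ (t : ℝ) ≤
      ENNReal.ofReal (3 ^ (t : ℝ)) := by
    filter_upwards [eventually_lqSum_le ν hsupp hb] with n hn
    have hcard := (card_mul_exp_le_lqSum ν hsupp q (-(n * Real.log 2 * c)) n (S n)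
      fun ω hω => (Finset.mem_filter.1 hω).2).trans hn
    calc ∑ ω : S n, Metric.ediam (wideCyl n ω.1) ^ (t : ℝ)
        ≤ ∑ _ω : S n, ENNReal.ofReal (3 * (1 / 2 ^ n)) ^ (t : ℝ) :=
          Finset.sum_le_sum fun ω _ => ENNReal.rpow_le_rpow (ediam_wideCyl_le n ω.1) t.coe_nonneg
      _ = ENNReal.ofReal ((S n).card * (3 * (1 / 2 ^ n)) ^ (t : ℝ)) := by
          rw [ENNReal.ofReal_mul (Nat.cast_nonneg _), ENNReal.ofReal_natCast,
            ← ENNReal.ofReal_rpow_of_nonneg (by positivity) t.coe_nonneg, Finset.sum_const,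
            Finset.card_univ, Fintype.card_coe, nsmul_eq_mul]
      _ ≤ ENNReal.ofReal (3 ^ (t : ℝ)) := by
          refine ENNReal.ofReal_le_ofReal ?_
          have hpow : ((1 : ℝ) / 2 ^ n) ^ (t : ℝ) = Real.exp (-(n * Real.log 2 * t)) := by
            rw [Real.rpow_def_of_pos (by positivity), one_div, Real.log_inv, Real.log_pow]
            ring_nf
          rw [Real.mul_rpow (by norm_num) (by positivity), hpow, mul_left_comm]
          refine mul_le_of_le_one_right (by positivity) ?_
          have hcard' : ((S n).card : ℝ) ≤ Real.exp (n * Real.log 2 * (b + c)) := by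
            rw [Real.exp_neg, ← div_eq_mul_inv, div_le_iff₀ (Real.exp_pos _),
              ← Real.exp_add] at hcard
            rwa [mul_add]
          refine (mul_le_mul_of_nonneg_right hcard' (Real.exp_pos _).le).trans ?_
          rw [← Real.exp_add, Real.exp_le_one_iff]
          have hL : 0 ≤ (n : ℝ) * Real.log 2 := by
            have := Real.log_pos one_lt_two
            positivity
          nlinarith
  refine dimH_le_of_hausdorffMeasure_ne_top (ne_top_of_le_ne_top
    (ENNReal.ofReal_ne_top (r := 3 ^ (t : ℝ))) (hmeas.trans ?_))
  exact liminf_le_of_frequently_le' hsum.frequently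

lemma dimH_hasLocDim_le (hsupp : ∀ U : Set Torus, IsOpen U → U.Nonempty → 0 < ν U)
    {α q b : ℝ} {t : NNReal} (hb : lqUpper ν q < b) (ht : q * α + b < t) :
    dimH {x : Torus | HasLocDim ν x α} ≤ t := by
  set ε : ℝ := t - (q * α + b) with hε
  have hεpos : 0 < ε := sub_pos.2 ht
  let E : ℕ → Set Torus := fun N => {x | ∀ n ≥ N, ∃ ω : Fin n → Bool, x ∈ wideCyl n ω ∧
    -(n * Real.log 2 * (q * α + ε)) ≤ q * Real.log (ν (cyl n ω)).toReal}
  have hsub : {x : Torus | HasLocDim ν x α} ⊆ ⋃ N, E N := fun x hx =>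
    Set.mem_iUnion.2 (eventually_atTop.1 (HasLocDim.eventually_exists_cyl ν hsupp hx q hεpos))
  refine (dimH_mono hsub).trans ?_
  rw [dimH_iUnion]
  exact iSup_le fun N => dimH_le_of_forall_exists_cyl ν hsupp hb (by linarith) fun x hx => hx

end Measure

/-- if `ν` has full topological support and its `L^q`-spectrum exists for
all `q`, then `dim_H {x : d_ν(x) = α} ≤ max {−β*(−α), 0}`, where
`β*(a) = sup_q (q a − β_ν(q))`. -/
theorem stmt13 (ν : Measure Torus) [IsProbabilityMeasure ν]
    (hsupp : ∀ U : Set Torus, IsOpen U → U.Nonempty → 0 < ν U)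
    (hex : ∀ q : ℝ, lqUpper ν q = lqLower ν q) (α : ℝ) :
    dimH {x : Torus | HasLocDim ν x α} ≤
      erealToENNReal
        (max (-(⨆ q : ℝ, ((q * (-α) : ℝ) : EReal) - lqUpper ν q)) 0) := by
  by_cases htop : max (-(⨆ q : ℝ, ((q * (-α) : ℝ) : EReal) - lqUpper ν q)) 0 = ⊤
  · rw [erealToENNReal, if_pos htop]
    exact le_top
  by_contra! hlt
  obtain ⟨t, hMt, ht⟩ := ENNReal.lt_iff_exists_nnreal_btwn.1 hlt
  refine ht.not_ge ?_
  rw [erealToENNReal, if_neg htop, ← ENNReal.ofReal_coe_nnreal] at hMt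
  have hbot : max (-(⨆ q : ℝ, ((q * (-α) : ℝ) : EReal) - lqUpper ν q)) 0 ≠ ⊥ :=
    (EReal.bot_lt_zero.trans_le (le_max_right _ _)).ne'
  have hMt' := EReal.coe_lt_coe_iff.2 (ENNReal.ofReal_lt_ofReal_iff'.1 hMt).1
  rw [EReal.coe_toReal htop hbot] at hMt'
  have hS := EReal.neg_lt_comm.1 ((le_max_left _ _).trans_lt hMt')
  obtain ⟨q, hq⟩ := lt_iSup_iff.1 hS
  have hβ : lqUpper ν q < ((t - q * α : ℝ) : EReal) := by
    generalize lqUpper ν q = β at hq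
    induction β with
    | bot => exact EReal.bot_lt_coe _
    | top => simp at hq
    | coe β =>
      norm_cast at hq ⊢
      linarith
  obtain ⟨b, hb, hbt⟩ := EReal.lt_iff_exists_real_btwn.1 hβ
  have hbt := EReal.coe_lt_coe_iff.1 hbt
  exact dimH_hasLocDim_le ν hsupp hb (by linarith)

end GTM
end
end
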